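/- arXiv:1701.03276 — 3 statements merged into one kernel-verified Lean document; each statement's English description precedes it below -/
import Mathlib

section
/- Let k ≥ 1 and let λ be analytic near 0 ∈ ℂ with λ(δ) = δ^k·σ(δ), where σ is analytic near 0 and σ(0) ≠ 0 (so λ has a zero of order exactly k). Let c denote the coefficient of δ^k in the Taylor expansion at 0 of 1/σ, i.e. c = (1/k!)·(d^k/dδ^k)(1/σ)(0) (equivalently, c is the constant term of the Laurent series of 1/λ at 0). Then the limit, as δ → 0 with δ ≠ 0, of the sum Σ_{j=0}^{k} 1/λ(e^{2πij/(k+1)}·δ) exists and equals (k+1)·c. (The sum is the sum of 1/λ over the k+1 solutions of δ'^{k+1} = δ^{k+1}, and the statement says that it extends continuously to ε = 0 with value k+1 times the constant term of the Laurent series of 1/λ.) -/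
open Metric Set Filter Complex Topology

/-- The `m`-th power sum over the `n`-th roots of unity vanishes when `0 < m < n`. -/
theorem IsPrimitiveRoot.sum_pow_pow_eq_zero {R : Type*} [CommRing R] [IsDomain R] {ζ : R}
    {n m : ℕ} (hζ : IsPrimitiveRoot ζ n) (hm : 0 < m) (hmn : m < n) :
    ∑ j ∈ Finset.range n, (ζ ^ j) ^ m = 0 := by
  have h1 : ζ ^ m - 1 ≠ 0 := sub_ne_zero.2 (hζ.pow_ne_one_of_pos_of_lt hm.ne' hmn)
  have h2 := mul_geom_sum (ζ ^ m) n
  rw [← pow_mul, mul_comm m n, pow_mul, hζ.pow_eq_one, one_pow, sub_self] at h2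
  rw [← (mul_eq_zero.1 h2).resolve_left h1]
  exact Finset.sum_congr rfl fun j _ => by rw [← pow_mul, ← pow_mul, mul_comm]

/-- Averaging a polynomial divided by `z ^ k` over the `(k + 1)`-st roots of unity extracts the
coefficient of `z ^ k`. -/
theorem IsPrimitiveRoot.sum_polynomial_div_pow {K : Type*} [Field K] {ζ : K} {k : ℕ}
    (hζ : IsPrimitiveRoot ζ (k + 1)) (a : ℕ → K) {z : K} (hz : z ≠ 0) :
    ∑ j ∈ Finset.range (k + 1), (∑ i ∈ Finset.range (k + 1), a i * (ζ ^ j * z) ^ i) /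
      (ζ ^ j * z) ^ k = ((k : K) + 1) * a k := by
  have hζ0 : ζ ≠ 0 := hζ.ne_zero k.succ_ne_zero
  have hterm : ∀ i j : ℕ, a i * (ζ ^ j * z) ^ i / (ζ ^ j * z) ^ k =
      a i * z ^ i / z ^ k * (ζ ^ j) ^ (i + 1) := fun i j => by
    have hj : (ζ ^ j) ^ k * ζ ^ j = 1 := by
      rw [← pow_succ, ← pow_mul, mul_comm, pow_mul, hζ.pow_eq_one, one_pow]
    rw [div_eq_iff (pow_ne_zero _ (mul_ne_zero (pow_ne_zero _ hζ0) hz)), mul_pow, mul_pow]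
    field_simp
    linear_combination (-(a i * (ζ ^ j) ^ i)) * hj
  simp_rw [Finset.sum_div, hterm]
  rw [Finset.sum_comm]
  simp_rw [← Finset.mul_sum]
  rw [Finset.sum_range_succ, Finset.sum_eq_zero, zero_add]
  · have : ∀ j : ℕ, (ζ ^ j) ^ (k + 1) = 1 := fun j => by
      rw [← pow_mul, mul_comm, pow_mul, hζ.pow_eq_one, one_pow]
    simp [this, hz, mul_comm]
  · intro i hi
    rw [hζ.sum_pow_pow_eq_zero i.succ_pos (by simpa using hi), mul_zero]

/-- If `f` is analytic at `0`, the sums of `f z / z ^ k` over the vertices of a shrinking regular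
`(k + 1)`-gon centred at `0` converge to `k + 1` times the `k`-th Taylor coefficient of `f`. -/
theorem AnalyticAt.tendsto_sum_div_pow {f : ℂ → ℂ} (hf : AnalyticAt ℂ f 0) {ζ : ℂ} {k : ℕ}
    (hζ : IsPrimitiveRoot ζ (k + 1)) :
    Tendsto (fun z => ∑ j ∈ Finset.range (k + 1), f (ζ ^ j * z) / (ζ ^ j * z) ^ k) (𝓝[≠] 0)
      (𝓝 (((k : ℂ) + 1) * (iteratedDeriv k f 0 / (k.factorial : ℂ)))) := by
  set a : ℕ → ℂ := fun i => iteratedDeriv i f 0 / (i.factorial : ℂ) with ha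
  set P : ℂ → ℂ := fun w => ∑ i ∈ Finset.range (k + 1), a i * w ^ i with hP
  have hO : (fun w => f w - P w) =O[𝓝 0] fun w => w ^ (k + 1) := by
    have := hf.hasFPowerSeriesAt.isBigO_sub_partialSum_pow (k + 1)
    simp only [zero_add] at this
    refine (this.congr_left fun w => ?_).trans (Asymptotics.isBigO_of_le _ fun w => by simp)
    simp [FormalMultilinearSeries.partialSum, hP, ha, mul_comm]
  have ho : (fun w => f w - P w) =o[𝓝 0] fun w => w ^ k :=
    hO.trans_isLittleO (Asymptotics.isLittleO_pow_pow k.lt_succ_self)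
  have hR : Tendsto (fun z => ∑ j ∈ Finset.range (k + 1),
      (f (ζ ^ j * z) - P (ζ ^ j * z)) / (ζ ^ j * z) ^ k) (𝓝[≠] 0) (𝓝 0) := by
    have hmul (j : ℕ) : Tendsto (fun z : ℂ => ζ ^ j * z) (𝓝[≠] 0) (𝓝 0) :=
      ((continuous_const_mul (ζ ^ j)).tendsto' 0 0 (mul_zero _)).mono_left nhdsWithin_le_nhds
    simpa using tendsto_finsetSum (Finset.range (k + 1)) fun j _ =>
      ho.tendsto_div_nhds_zero.comp (hmul j)
  refine (zero_add (((k : ℂ) + 1) * a k) ▸ hR.add_const (((k : ℂ) + 1) * a k)).congr' ?_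
  filter_upwards [self_mem_nhdsWithin] with z hz
  rw [← hζ.sum_polynomial_div_pow a hz, ← Finset.sum_add_distrib]
  exact Finset.sum_congr rfl fun j _ => by rw [← add_div, sub_add_cancel]

open Metric Set Filter Complex Topology

/-- Let `λ(δ) = δ^k·σ(δ)` with `σ` analytic near `0`, `σ(0) ≠ 0`, and let
`c` be the coefficient of `δ^k` in the Taylor expansion of `1/σ` at `0` (the constant term
of the Laurent series of `1/λ`). Then `Σ_{j=0}^{k} 1/λ(e^{2πij/(k+1)}·δ) → (k+1)·c` as
`δ → 0`, `δ ≠ 0`. -/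
theorem statement12 (k : ℕ) (hk : 1 ≤ k) (σ : ℂ → ℂ)
    (hσ : AnalyticAt ℂ σ 0) (hσ0 : σ 0 ≠ 0)
    (c : ℂ) (hc : c = iteratedDeriv k (fun δ => (σ δ)⁻¹) 0 / (Nat.factorial k : ℂ)) :
    Filter.Tendsto
      (fun δ : ℂ => ∑ j ∈ Finset.range (k + 1),
        ((Complex.exp (2 * Real.pi * Complex.I * (j : ℂ) / ((k : ℂ) + 1)) * δ) ^ k *
          σ (Complex.exp (2 * Real.pi * Complex.I * (j : ℂ) / ((k : ℂ) + 1)) * δ))⁻¹)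
      (𝓝[≠] (0 : ℂ)) (𝓝 (((k : ℂ) + 1) * c)) := by
  have hζ : IsPrimitiveRoot (exp (2 * Real.pi * I / ((k : ℂ) + 1))) (k + 1) := by
    simpa using Complex.isPrimitiveRoot_exp (k + 1) k.succ_ne_zero
  rw [hc]
  refine ((hσ.inv hσ0).tendsto_sum_div_pow hζ).congr fun δ => Finset.sum_congr rfl fun j _ => ?_
  have hexp : exp (2 * Real.pi * I * (j : ℂ) / ((k : ℂ) + 1)) =
      exp (2 * Real.pi * I / ((k : ℂ) + 1)) ^ j := by
    rw [← Complex.exp_nat_mul]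
    congr 1
    ring
  rw [hexp, mul_inv, div_eq_mul_inv, mul_comm]
  rfl
end

section
/- Let k ≥ 1. Let b_1, …, b_{k−1}, c_1, …, c_{k−1}, A, Ã be analytic functions near 0 ∈ ℂ with b_j(0) = c_j(0) = 0 for all j. Define P(z,ε) = z^{k+1} + Σ_{j=1}^{k−1} b_j(ε)·z^j − ε and P̃(z,ε) = z^{k+1} + Σ_{j=1}^{k−1} c_j(ε)·z^j − ε, and the families ω(z,ε) = P(z,ε)/(1 + A(ε)·z^k) and ω̃(z,ε) = P̃(z,ε)/(1 + Ã(ε)·z^k). Suppose there exist analytic functions φ(z,ε) near (0,0) and h(ε) near 0 with φ(0,0) = 0, ∂φ/∂z(0,0) ≠ 0, h(0) = 0, h'(0) ≠ 0, z ↦ φ(z,ε) injective near 0 for each small ε, and ∂φ/∂z(z,ε)·ω(z,ε) = ω̃(φ(z,ε), h(ε)) for all (z,ε) in a neighborhood of (0,0). Then there exists ν ∈ ℂ with ν^k = 1 such that, for all (z,ε) in a neighborhood of (0,0): h(ε) = ν·ε, A(ε) = Ã(ν·ε), and P̃(ν·z, ν·ε) = ν·P(z,ε) (equivalently, c_j(νε)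 = ν^{1−j}·b_j(ε) for each j). In particular the parameter in this Kostov-type normal form is canonical: it is unique up to multiplication by a k-th root of unity. -/
open Metric Set Filter Complex

/-- The monic centered polynomial `P_ε(z) = z^{k+1} + Σ_{j=1}^{k−1} b_j(ε) z^j − ε`
of a Kostov-type normal form. -/
noncomputable def kostovP (k : ℕ) (b : ℕ → ℂ → ℂ) (z ε : ℂ) : ℂ :=
  z ^ (k + 1) + (∑ j ∈ Finset.Icc 1 (k - 1), b j ε * z ^ j) - ε

open PowerSeries in
theorem derivative_X_pow_succ_mul {R : Type*} [CommRing R] (a : ℕ) (v : R⟦X⟧) :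
    derivative R (X ^ (a + 1) * v)
      = X ^ a * (((a : R⟦X⟧) + 1) * v + X * derivative R v) := by
  rw [Derivation.leibniz, derivative_pow, derivative_X]
  simp only [smul_eq_mul, Nat.add_sub_cancel]
  push_cast
  ring

open PowerSeries in
theorem conj_monomial_field (k : ℕ) (hk : 1 ≤ k) (f : ℂ⟦X⟧) (α β : ℂ)
    (hf0 : constantCoeff f = 0) (hf1 : coeff 1 f = 1)
    (hf : derivative ℂ f * X ^ (k + 1) * (1 + C β * f ^ k) = f ^ (k + 1) * (1 + C α * X ^ k)) :
    X ^ (k + 1) ∣ f - X ∧ α = β := by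
  obtain ⟨g, rfl⟩ := X_dvd_iff.2 hf0
  have hg : constantCoeff g = 1 := by
    rw [← hf1, show (1 : ℕ) = 0 + 1 from rfl, coeff_succ_X_mul, coeff_zero_eq_constantCoeff_apply]
  have hX (n : ℕ) : (X : ℂ⟦X⟧) ^ n ≠ 0 := pow_ne_zero _ X_ne_zero
  have E : (g + X * derivative ℂ g) * (1 + C β * X ^ k * g ^ k)
      = g ^ (k + 1) * (1 + C α * X ^ k) := by
    apply mul_left_cancel₀ (hX (k + 1))
    rw [Derivation.leibniz, derivative_X] at hf
    simp only [smul_eq_mul] at hf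
    linear_combination hf
  have key : ∀ j, j + 1 ≤ k → X ^ (j + 1) ∣ g - 1 := by
    intro j
    induction j with
    | zero =>
      intro _
      rw [zero_add, pow_one, X_dvd_iff]
      simp [hg]
    | succ a ih =>
      intro hak
      obtain ⟨v, hv⟩ := ih (by omega)
      obtain ⟨i, rfl⟩ : ∃ i, k = a + 1 + 1 + i := ⟨k - (a + 2), by omega⟩
      have hgv : g = 1 + X ^ (a + 1) * v := by linear_combination hv
      have hD : derivative ℂ g = X ^ a * (((a : ℂ⟦X⟧) + 1) * v + X * derivative ℂ v) := by
        rw [hgv, map_add, derivative_X_pow_succ_mul, derivative_one, zero_add]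
      obtain ⟨m, hm⟩ := Polynomial.powAddExpansion 1 (X ^ (a + 1) * v) (a + 1 + 1 + i + 1)
      have h0 : v + ((a : ℂ⟦X⟧) + 1) * v + X * derivative ℂ v
          + (g + X * derivative ℂ g) * (C β * X * X ^ i * g ^ (a + 1 + 1 + i))
          = ((a : ℂ⟦X⟧) + 1 + 1 + (i : ℂ⟦X⟧) + 1) * v + m * X ^ a * X * v ^ 2
            + g ^ (a + 1 + 1 + i + 1) * C α * X * X ^ i := by
        apply mul_left_cancel₀ (hX (a + 1))
        rw [← hgv] at hm
        push_cast at hm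
        simp only [one_pow, mul_one] at hm
        linear_combination E + hm - hgv - X * hD
      have h1 := congrArg constantCoeff h0
      simp only [map_add, map_mul, constantCoeff_X, constantCoeff_one, map_natCast, mul_zero,
        zero_mul, add_zero] at h1
      have h2 : constantCoeff v * ((i : ℂ) + 1) = 0 := by linear_combination -h1
      have h3 : constantCoeff v = 0 := by
        rcases mul_eq_zero.1 h2 with h | h
        · exact h
        · exact absurd h (Nat.cast_add_one_ne_zero i)
      obtain ⟨w, hw⟩ := X_dvd_iff.2 h3
      exact ⟨w, by rw [hv, hw]; ring⟩
  obtain ⟨a, rfl⟩ : ∃ a, k = a + 1 := ⟨k - 1, by omega⟩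
  obtain ⟨v, hv⟩ := key a le_rfl
  refine ⟨⟨v, by linear_combination X * hv⟩, ?_⟩
  have hgv : g = 1 + X ^ (a + 1) * v := by linear_combination hv
  have hD : derivative ℂ g = X ^ a * (((a : ℂ⟦X⟧) + 1) * v + X * derivative ℂ v) := by
    rw [hgv, map_add, derivative_X_pow_succ_mul, derivative_one, zero_add]
  obtain ⟨m, hm⟩ := Polynomial.powAddExpansion 1 (X ^ (a + 1) * v) (a + 1 + 1)
  have h0 : v + ((a : ℂ⟦X⟧) + 1) * v + X * derivative ℂ v
      + (g + X * derivative ℂ g) * (C β * g ^ (a + 1))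
      = ((a : ℂ⟦X⟧) + 1 + 1) * v + m * X ^ a * X * v ^ 2
        + g ^ (a + 1 + 1) * C α := by
    apply mul_left_cancel₀ (hX (a + 1))
    rw [← hgv] at hm
    push_cast at hm
    simp only [one_pow, mul_one] at hm
    linear_combination E + hm - hgv - X * hD
  have h1 := congrArg constantCoeff h0
  simp only [map_add, map_mul, map_pow, constantCoeff_X, constantCoeff_one, constantCoeff_C,
    map_natCast, mul_zero, zero_mul, add_zero, hg, one_pow, mul_one, one_mul] at h1
  linear_combination -h1

open PowerSeries in
/-- The linearised conjugacy equation at a germ `f = z + O(z^{k+1})`, modulo `z^{2k+2}`. -/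
theorem linearized_conj_eq_zero (k : ℕ) (hk : 1 ≤ k) (u r ψ : ℂ⟦X⟧) (β s : ℂ)
    (hr : ∀ n, k ≤ n → coeff n r = 0)
    (f : ℂ⟦X⟧) (hf : f = X + X ^ (k + 1) * u)
    (h : X ^ (2 * k + 2) ∣ derivative ℂ ψ * X ^ (k + 1) * (1 + C β * f ^ k)
      + derivative ℂ f * r * (1 + C β * f ^ k)
      + derivative ℂ f * X ^ (k + 1) * (C β * ((k : ℂ⟦X⟧) * f ^ (k - 1) * ψ))
      - ((k : ℂ⟦X⟧) + 1) * f ^ k * ψ * (1 + C β * X ^ k)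
      - f ^ (k + 1) * (C s * X ^ k)) :
    r = 0 ∧ X ^ (k + 1) ∣ ψ ∧ s = 0 := by
  obtain ⟨l, rfl⟩ : ∃ l, k = l + 1 := ⟨k - 1, by omega⟩
  have hX (n : ℕ) : (X : ℂ⟦X⟧) ^ n ≠ 0 := pow_ne_zero _ X_ne_zero
  obtain ⟨w, hw⟩ : ∃ w, w = 1 + X ^ (l + 1) * u := ⟨_, rfl⟩
  have hfw : f = X * w := by rw [hf, hw]; ring
  have hw0 : constantCoeff w = 1 := by simp [hw]
  have hDf : constantCoeff (derivative ℂ f) = 1 := by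
    rw [hfw, Derivation.leibniz, derivative_X]
    simp [hw0]
  obtain ⟨M, hM⟩ := h
  simp only [Nat.add_sub_cancel] at hM
  push_cast at hM
  have hr0 : r = 0 := by
    have hu : IsUnit (derivative ℂ f * (1 + C β * f ^ (l + 1))) := by
      rw [isUnit_iff_constantCoeff]
      rw [map_mul, hDf]
      simp [hfw]
    have hd : X ^ (l + 1) ∣ (derivative ℂ f * (1 + C β * f ^ (l + 1))) * r := by
      refine ⟨X ^ (l + 3) * M - (derivative ℂ ψ * X * (1 + C β * f ^ (l + 1))
        + derivative ℂ f * X * (C β * (((l : ℂ⟦X⟧) + 1) * f ^ l * ψ))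
        - ((l : ℂ⟦X⟧) + 1 + 1) * w ^ (l + 1) * ψ * (1 + C β * X ^ (l + 1))
        - f ^ (l + 1 + 1) * C s), ?_⟩
      have hfk : f ^ (l + 1) = X ^ (l + 1) * w ^ (l + 1) := by rw [hfw, mul_pow]
      linear_combination hM + ((l : ℂ⟦X⟧) + 1 + 1) * ψ * (1 + C β * X ^ (l + 1)) * hfk
    rw [hu.dvd_mul_left, X_pow_dvd_iff] at hd
    ext n
    rcases lt_or_ge n (l + 1) with hn | hn
    · simpa using hd n hn
    · simpa using hr n hn
  subst hr0
  have hfk (n : ℕ) : f ^ n = X ^ n * w ^ n := by rw [hfw, mul_pow]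
  simp only [hfk] at hM
  have hd1 : X ^ 1 ∣ ψ := by
    rw [pow_one, X_dvd_iff]
    have h0 : derivative ℂ ψ * X * (1 + C β * (X ^ (l + 1) * w ^ (l + 1)))
        + derivative ℂ f * X * (C β * (((l : ℂ⟦X⟧) + 1) * (X ^ l * w ^ l) * ψ))
        - ((l : ℂ⟦X⟧) + 1 + 1) * w ^ (l + 1) * ψ * (1 + C β * X ^ (l + 1))
        - X ^ l * X ^ 2 * w ^ (l + 1 + 1) * C s = X ^ l * X ^ 3 * M := by
      apply mul_left_cancel₀ (hX (l + 1))
      linear_combination hM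
    have h1 := congrArg constantCoeff h0
    simp only [map_add, map_sub, map_mul, map_pow, constantCoeff_X, constantCoeff_one,
      constantCoeff_C, map_natCast, mul_zero, zero_mul, add_zero, hw0, one_pow, mul_one,
      pow_succ, sub_zero, zero_sub] at h1
    have h2 : ((l : ℂ) + 1 + 1) * constantCoeff ψ = 0 := by linear_combination -h1
    refine (mul_eq_zero.1 h2).resolve_left ?_
    exact_mod_cast (by omega : l + 1 + 1 ≠ 0)
  have key : ∀ j, j ≤ l + 1 → X ^ (j + 1) ∣ ψ := by
    intro j
    induction j with
    | zero => intro _; exact hd1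
    | succ j ih =>
      intro hj
      obtain ⟨v, hv⟩ := ih (by omega)
      obtain ⟨i, rfl⟩ : ∃ i, l = j + i := ⟨l - j, by omega⟩
      have hD : derivative ℂ ψ = X ^ j * (((j : ℂ⟦X⟧) + 1) * v + X * derivative ℂ v) := by
        rw [hv, derivative_X_pow_succ_mul]
      have h0 : (((j : ℂ⟦X⟧) + 1) * v + X * derivative ℂ v)
            * (1 + C β * (X ^ (j + i + 1) * w ^ (j + i + 1)))
          + derivative ℂ f * X * (C β * (((j : ℂ⟦X⟧) + (i : ℂ⟦X⟧) + 1) * (X ^ (j + i) * w ^ (j + i)) * v))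
          - ((j : ℂ⟦X⟧) + (i : ℂ⟦X⟧) + 1 + 1) * w ^ (j + i + 1) * v * (1 + C β * X ^ (j + i + 1))
          - X ^ (i + 1) * w ^ (j + i + 1 + 1) * C s = X ^ i * X ^ 2 * M := by
        apply mul_left_cancel₀ (hX (j + i + 1 + j + 1))
        push_cast at hM
        rw [hD, hv] at hM
        linear_combination hM
      have h1 := congrArg constantCoeff h0
      simp only [map_add, map_sub, map_mul, map_pow, constantCoeff_X, constantCoeff_one,
        constantCoeff_C, map_natCast, mul_zero, zero_mul, add_zero, hw0, one_pow, mul_one,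
        pow_succ, sub_zero] at h1
      have h2 : ((i : ℂ) + 1) * constantCoeff v = 0 := by linear_combination -h1
      have h3 : constantCoeff v = 0 := by
        refine (mul_eq_zero.1 h2).resolve_left ?_
        exact_mod_cast (by omega : i + 1 ≠ 0)
      obtain ⟨w, hw⟩ := X_dvd_iff.2 h3
      exact ⟨w, by rw [hv, hw]; ring⟩
  refine ⟨rfl, key _ le_rfl, ?_⟩
  obtain ⟨v, hv⟩ := key _ le_rfl
  have hD : derivative ℂ ψ = X ^ (l + 1) * (((l : ℂ⟦X⟧) + 1 + 1) * v + X * derivative ℂ v) := by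
    rw [hv, derivative_X_pow_succ_mul]
    push_cast
    rfl
  have h0 : (((l : ℂ⟦X⟧) + 1 + 1) * v + X * derivative ℂ v)
        * (1 + C β * (X ^ (l + 1) * w ^ (l + 1)))
      + derivative ℂ f * X * (C β * (((l : ℂ⟦X⟧) + 1) * (X ^ l * w ^ l) * v))
      - ((l : ℂ⟦X⟧) + 1 + 1) * w ^ (l + 1) * v * (1 + C β * X ^ (l + 1))
      - w ^ (l + 1 + 1) * C s = X * M := by
    apply mul_left_cancel₀ (hX (l + 1 + 1 + l + 1))
    rw [hD, hv] at hM
    linear_combination hM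
  have h1 := congrArg constantCoeff h0
  simp only [map_add, map_sub, map_mul, map_pow, constantCoeff_X, constantCoeff_one,
    constantCoeff_C, map_natCast, mul_zero, zero_mul, add_zero, hw0, one_pow, mul_one, one_mul,
    pow_succ] at h1
  linear_combination -h1

open PowerSeries in
theorem C_X_dvd_iff_map_constantCoeff_eq_zero {f : ℂ⟦X⟧⟦X⟧} :
    C X ∣ f ↔ map constantCoeff f = 0 := by
  constructor
  · rintro ⟨g, rfl⟩
    simp
  · intro h
    have h' (n : ℕ) : X ∣ coeff n f := by
      rw [X_dvd_iff, ← coeff_map, h, map_zero]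
    choose g hg using h'
    refine ⟨mk g, ?_⟩
    ext1 n
    rw [coeff_C_mul, coeff_mk, hg]

open PowerSeries in
theorem prime_C_X : Prime (C X : ℂ⟦X⟧⟦X⟧) := by
  refine ⟨fun h => ?_, fun h => ?_, fun a b h => ?_⟩
  · exact X_ne_zero (C_injective (h.trans (map_zero C).symm))
  · have := h.map (map constantCoeff : ℂ⟦X⟧⟦X⟧ →+* ℂ⟦X⟧)
    simp at this
  · simpa only [C_X_dvd_iff_map_constantCoeff_eq_zero, map_mul, mul_eq_zero] using h

open PowerSeries in
theorem map_constantCoeff_derivative (f : ℂ⟦X⟧⟦X⟧) :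
    map constantCoeff (derivative ℂ⟦X⟧ f) = derivative ℂ (map constantCoeff f) := by
  ext n
  simp [coeff_derivative]

open PowerSeries in
theorem map_constantCoeff_eval₂ (p : Polynomial ℂ⟦X⟧) (w : ℂ⟦X⟧⟦X⟧) :
    map constantCoeff (p.eval₂ C w)
      = (p.map constantCoeff).eval₂ C (map constantCoeff w) := by
  rw [Polynomial.hom_eval₂, Polynomial.eval₂_map]
  congr 1
  ext1 x
  simp

open PowerSeries in
theorem coeff_eval₂_C_X {R : Type*} [CommRing R] (p : Polynomial R) (n : ℕ) :
    coeff n (p.eval₂ C (X : R⟦X⟧)) = p.coeff n := by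
  induction p using Polynomial.induction_on' with
  | add p q hp hq => simp [Polynomial.eval₂_add, hp, hq]
  | monomial i a =>
    rw [Polynomial.eval₂_monomial, coeff_C_mul_X_pow, Polynomial.coeff_monomial]
    simp [eq_comm]

theorem eval₂_add_expansion {R S : Type*} [CommRing R] [CommRing S] (i : R →+* S)
    (q : Polynomial R) (x y : S) :
    ∃ m, q.eval₂ i (x + y)
      = q.eval₂ i x + (Polynomial.derivative q).eval₂ i x * y + m * y ^ 2 := by
  obtain ⟨m, hm⟩ := Polynomial.binomExpansion (q.map i) x y
  refine ⟨m, ?_⟩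
  simpa only [Polynomial.derivative_map, Polynomial.eval_map] using hm

open PowerSeries in
theorem derivative_mul' {R : Type*} [CommRing R] (f g : R⟦X⟧) :
    derivative R (f * g) = f * derivative R g + g * derivative R f :=
  Derivation.leibniz _ f g

open PowerSeries in
theorem derivative_eval₂_C_X {R : Type*} [CommRing R] (p : Polynomial R) :
    derivative R (p.eval₂ C (X : R⟦X⟧)) = (Polynomial.derivative p).eval₂ C X := by
  ext n
  rw [coeff_derivative, coeff_eval₂_C_X, coeff_eval₂_C_X, Polynomial.coeff_derivative]

theorem conj_expansion {S : Type*} [CommRing S] (E d₁ d₂ Q r L B t m g g' g'' H s : S) :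
    ∃ N, (d₁ + E * d₂) * (Q + E * r) * (L + B * (t * E + m * E ^ 2))
        - (g + g' * E + g'' * E ^ 2) * (H + E * s)
      = d₁ * Q * L - g * H
        + E * (d₂ * Q * L + d₁ * r * L + d₁ * Q * (B * t) - g' * H - g * s) + E ^ 2 * N :=
  ⟨d₂ * r * L + d₂ * Q * B * t + d₁ * r * B * t + d₁ * Q * B * m
    + E * (d₂ * r * B * t + d₂ * Q * B * m + d₁ * r * B * m) + E ^ 2 * (d₂ * r * B * m)
    - (g'' * H + g' * s + E * (g'' * s)), by ring⟩

open PowerSeries in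
theorem formal_conj_step (k : ℕ) (hk : 1 ≤ k) (n : ℕ) (hn : 1 ≤ n)
    (q r : Polynomial ℂ⟦X⟧) (hr : ∀ i, k ≤ i → r.coeff i = 0)
    (hq : q.map constantCoeff = Polynomial.X ^ (k + 1)) (B s : ℂ⟦X⟧) (u ψ φ : ℂ⟦X⟧⟦X⟧)
    (hφ : φ = X + q.eval₂ C X * u + C X ^ n * ψ)
    (h : derivative ℂ⟦X⟧ φ * (q.eval₂ C X + C X ^ n * r.eval₂ C X)
        * (1 + C B * φ ^ k)
      = q.eval₂ C φ * (1 + (C B + C X ^ n * C s) * X ^ k)) :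
    (∃ r', r = Polynomial.C X * r') ∧ (∃ s', s = X * s') ∧
      ∃ v ψ', ψ = q.eval₂ C X * v + C X * ψ' := by
  set Q : ℂ⟦X⟧⟦X⟧ := q.eval₂ C X with hQ
  set Q' : ℂ⟦X⟧⟦X⟧ := (Polynomial.derivative q).eval₂ C X with hQ'
  set e : ℂ⟦X⟧⟦X⟧ := C X with he
  set f : ℂ⟦X⟧⟦X⟧ := X + Q * u with hf
  have hDQ : derivative ℂ⟦X⟧ Q = Q' := by
    rw [hQ, derivative_eval₂_C_X]
  have hDf : derivative ℂ⟦X⟧ f = 1 + Q' * u + Q * derivative ℂ⟦X⟧ u := by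
    rw [hf, map_add, derivative_mul', hDQ, derivative_X]
    ring
  have hDφ : derivative ℂ⟦X⟧ φ = derivative ℂ⟦X⟧ f + e ^ n * derivative ℂ⟦X⟧ ψ := by
    rw [hφ, map_add, he, ← map_pow, derivative_mul', derivative_C]
    simp
  obtain ⟨m₁, hm₁⟩ := eval₂_add_expansion C q f (e ^ n * ψ)
  obtain ⟨m₂, hm₂⟩ := Polynomial.powAddExpansion f (e ^ n * ψ) k
  obtain ⟨m₃, hm₃⟩ := eval₂_add_expansion C q X (Q * u)
  obtain ⟨m₄, hm₄⟩ := Polynomial.powAddExpansion X (Q * u) k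
  rw [← hφ] at hm₁ hm₂
  rw [← hf, ← hQ, ← hQ'] at hm₃
  rw [← hf] at hm₄
  obtain ⟨N, hN⟩ := conj_expansion (e ^ n) (derivative ℂ⟦X⟧ f) (derivative ℂ⟦X⟧ ψ) Q
    (r.eval₂ C X) (1 + C B * f ^ k) (C B) ((k : ℂ⟦X⟧⟦X⟧) * f ^ (k - 1) * ψ) (m₂ * ψ ^ 2)
    (q.eval₂ C f) ((Polynomial.derivative q).eval₂ C f * ψ) (m₁ * ψ ^ 2)
    (1 + C B * X ^ k) (C s * X ^ k)
  set T := derivative ℂ⟦X⟧ ψ * Q * (1 + C B * f ^ k)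
    + derivative ℂ⟦X⟧ f * r.eval₂ C X * (1 + C B * f ^ k)
    + derivative ℂ⟦X⟧ f * Q * (C B * ((k : ℂ⟦X⟧⟦X⟧) * f ^ (k - 1) * ψ))
    - (Polynomial.derivative q).eval₂ C f * ψ * (1 + C B * X ^ k)
    - q.eval₂ C f * (C s * X ^ k) with hT
  set l : ℂ⟦X⟧⟦X⟧ := (k : ℂ⟦X⟧⟦X⟧) * X ^ (k - 1) * u + m₄ * Q * u ^ 2 with hl
  set K := derivative ℂ⟦X⟧ u * (1 + C B * X ^ k)
    + (1 + Q' * u + Q * derivative ℂ⟦X⟧ u) * (C B * l) - m₃ * u ^ 2 * (1 + C B * X ^ k) with hK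
  have hfk : f ^ k = X ^ k + Q * l := by rw [hm₄, hl]; ring
  have hE : derivative ℂ⟦X⟧ f * Q * (1 + C B * f ^ k) - q.eval₂ C f * (1 + C B * X ^ k)
      = Q ^ 2 * K := by
    rw [hfk, hDf, hm₃, hK]
    ring
  have hsum : Q ^ 2 * K + e ^ n * T + (e ^ n) ^ 2 * N = 0 := by
    rw [hE] at hN
    rw [← hN, sub_eq_zero]
    rw [hDφ, hm₁, hm₂] at h
    linear_combination h
  have hπe : map constantCoeff e = 0 := by simp [he]
  have hπQ : map constantCoeff Q = X ^ (k + 1) := by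
    rw [hQ, map_constantCoeff_eval₂, hq]
    simp
  have hen : e ^ n ∣ K := by
    refine prime_C_X.pow_dvd_of_dvd_mul_left n (a := Q ^ 2) (fun hd => ?_)
      ⟨-(T + e ^ n * N), by linear_combination hsum⟩
    rw [C_X_dvd_iff_map_constantCoeff_eq_zero, map_pow, hπQ, ← pow_mul] at hd
    exact pow_ne_zero _ X_ne_zero hd
  obtain ⟨K', hK'⟩ := hen
  have hred : Q ^ 2 * K' + T + e ^ n * N = 0 := by
    apply mul_left_cancel₀ (pow_ne_zero n prime_C_X.ne_zero)
    rw [← he]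
    linear_combination hsum - Q ^ 2 * hK'
  have hπ := congrArg (map constantCoeff : ℂ⟦X⟧⟦X⟧ →+* ℂ⟦X⟧) hred
  rw [map_add, map_add, map_mul, map_mul, map_pow, map_pow, hπQ, hπe, zero_pow (by omega),
    zero_mul, add_zero, map_zero] at hπ
  have hπf : map constantCoeff f = X + X ^ (k + 1) * map constantCoeff u := by
    rw [hf, map_add, map_mul, hπQ, map_X]
  have hπT : map constantCoeff T
      = derivative ℂ (map constantCoeff ψ) * X ^ (k + 1)
          * (1 + C (constantCoeff B) * map constantCoeff f ^ k)
      + derivative ℂ (map constantCoeff f) * map constantCoeff (r.eval₂ C X)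
          * (1 + C (constantCoeff B) * map constantCoeff f ^ k)
      + derivative ℂ (map constantCoeff f) * X ^ (k + 1)
          * (C (constantCoeff B) * ((k : ℂ⟦X⟧) * map constantCoeff f ^ (k - 1)
            * map constantCoeff ψ))
      - ((k : ℂ⟦X⟧) + 1) * map constantCoeff f ^ k * map constantCoeff ψ
          * (1 + C (constantCoeff B) * X ^ k)
      - map constantCoeff f ^ (k + 1) * (C (constantCoeff s) * X ^ k) := by
    have h1 : map constantCoeff (q.eval₂ C f) = map constantCoeff f ^ (k + 1) := by
      rw [map_constantCoeff_eval₂, hq]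
      simp
    have h2 : map constantCoeff ((Polynomial.derivative q).eval₂ C f)
        = ((k : ℂ⟦X⟧) + 1) * map constantCoeff f ^ k := by
      rw [map_constantCoeff_eval₂, ← Polynomial.derivative_map, hq]
      simp
    rw [hT]
    simp only [map_sub, map_add, map_mul, map_pow, map_one, map_natCast, map_C, map_X,
      map_constantCoeff_derivative, h1, h2, hπQ]
  obtain ⟨hr0, ⟨v, hv⟩, hs0⟩ := linearized_conj_eq_zero k hk (map constantCoeff u)
    (map constantCoeff (r.eval₂ C X)) (map constantCoeff ψ) (constantCoeff B)
    (constantCoeff s)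
    (fun i hi => by rw [coeff_map, coeff_eval₂_C_X, hr i hi, map_zero]) _ hπf
    (by rw [← hπT]; exact ⟨-map constantCoeff K', by linear_combination hπ⟩)
  refine ⟨?_, X_dvd_iff.2 hs0, map C v, ?_⟩
  · change Polynomial.C X ∣ r
    rw [Polynomial.C_dvd_iff_dvd_coeff]
    intro i
    rw [X_dvd_iff, ← coeff_eval₂_C_X, ← coeff_map, hr0, map_zero]
  · have : e ∣ ψ - Q * map C v := by
      rw [he, C_X_dvd_iff_map_constantCoeff_eq_zero, map_sub, map_mul, hπQ, hv, sub_eq_zero]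
      congr 1
    obtain ⟨ψ', h'⟩ := this
    exact ⟨ψ', by linear_combination h'⟩

open PowerSeries in
theorem eq_zero_of_forall_X_pow_dvd {f : ℂ⟦X⟧} (h : ∀ n, X ^ (n + 1) ∣ f) : f = 0 := by
  ext n
  simpa using X_pow_dvd_iff.1 (h n) n n.lt_succ_self

open PowerSeries in
/-- Two formal families of centred monic polynomial normal forms conjugate by a change of
coordinate tangent to the identity are equal. -/
theorem formal_conj_rigid (k : ℕ) (hk : 1 ≤ k) (p q : Polynomial ℂ⟦X⟧)
    (hpq : ∀ i, k ≤ i → p.coeff i = q.coeff i)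
    (hp : p.map constantCoeff = Polynomial.X ^ (k + 1))
    (hq : q.map constantCoeff = Polynomial.X ^ (k + 1)) (A B : ℂ⟦X⟧) (φ : ℂ⟦X⟧⟦X⟧)
    (hφ0 : constantCoeff (coeff 0 φ) = 0) (hφ1 : constantCoeff (coeff 1 φ) = 1)
    (h : derivative ℂ⟦X⟧ φ * p.eval₂ C X * (1 + C B * φ ^ k)
      = q.eval₂ C φ * (1 + C A * X ^ k)) :
    p = q ∧ A = B := by
  have key : ∀ n, (∃ r, p = q + Polynomial.C X ^ (n + 1) * r) ∧ (∃ s, A = B + X ^ (n + 1) * s) ∧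
      ∃ u ψ, φ = X + q.eval₂ C X * u + C X ^ (n + 1) * ψ := by
    intro n
    induction n with
    | zero =>
      have h' := congrArg (map constantCoeff : ℂ⟦X⟧⟦X⟧ →+* ℂ⟦X⟧) h
      simp only [map_mul, map_add, map_one, map_pow, map_C, map_X, map_constantCoeff_derivative,
        map_constantCoeff_eval₂, hp, hq, Polynomial.eval₂_X_pow] at h'
      obtain ⟨⟨u, hu⟩, hAB⟩ := conj_monomial_field k hk _ _ _
        (by rw [← coeff_zero_eq_constantCoeff_apply, coeff_map, hφ0])
        (by rw [coeff_map, hφ1]) h'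
      refine ⟨?_, ?_, map C u, ?_⟩
      · have : Polynomial.C X ∣ p - q := by
          rw [Polynomial.C_dvd_iff_dvd_coeff]
          intro i
          rw [X_dvd_iff, Polynomial.coeff_sub, map_sub, ← Polynomial.coeff_map,
            ← Polynomial.coeff_map, hp, hq, sub_self]
        obtain ⟨r, hr⟩ := this
        exact ⟨r, by linear_combination hr⟩
      · have : X ∣ A - B := by rw [X_dvd_iff, map_sub, hAB, sub_self]
        obtain ⟨s, hs⟩ := this
        exact ⟨s, by linear_combination hs⟩
      · have : C X ∣ φ - X - q.eval₂ C X * map C u := by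
          rw [C_X_dvd_iff_map_constantCoeff_eq_zero, map_sub, map_sub, map_mul, map_X, hu,
            map_constantCoeff_eval₂, hq, map_X, Polynomial.eval₂_X_pow, sub_eq_zero]
          congr 1
        obtain ⟨ψ, hψ⟩ := this
        exact ⟨ψ, by linear_combination hψ⟩
    | succ n ih =>
      obtain ⟨⟨r, hr⟩, ⟨s, hs⟩, u, ψ, hφ⟩ := ih
      obtain ⟨⟨r', rfl⟩, ⟨s', rfl⟩, v, ψ', rfl⟩ := formal_conj_step k hk (n + 1) (by omega) q r
        (fun i hi => by
          have h1 := hpq i hi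
          rw [hr, Polynomial.coeff_add, ← map_pow, Polynomial.coeff_C_mul] at h1
          exact (mul_eq_zero.1 (add_eq_left.1 h1)).resolve_left (pow_ne_zero _ X_ne_zero))
        hq B s u ψ φ hφ (by
          have h1 : p.eval₂ C (X : ℂ⟦X⟧⟦X⟧)
              = q.eval₂ C X + C X ^ (n + 1) * r.eval₂ C X := by
            rw [hr, Polynomial.eval₂_add, Polynomial.eval₂_mul, Polynomial.eval₂_pow,
              Polynomial.eval₂_C]
          rw [h1, hs] at h
          simpa only [map_add, map_mul, map_pow] using h)
      exact ⟨⟨r', by rw [hr]; ring⟩, ⟨s', by rw [hs]; ring⟩, u + C X ^ (n + 1) * v, ψ',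
        by rw [hφ]; ring⟩
  constructor
  · ext1 i
    rw [← sub_eq_zero]
    refine eq_zero_of_forall_X_pow_dvd fun n => ?_
    obtain ⟨r, hr⟩ := (key n).1
    refine ⟨r.coeff i, ?_⟩
    rw [hr, Polynomial.coeff_add, ← map_pow, Polynomial.coeff_C_mul, add_sub_cancel_left]
  · rw [← sub_eq_zero]
    refine eq_zero_of_forall_X_pow_dvd fun n => ?_
    obtain ⟨s, hs⟩ := (key n).2.1
    exact ⟨s, by linear_combination hs⟩

open PowerSeries in
theorem formal_conj_classification (k : ℕ) (hk : 1 ≤ k) (p q : Polynomial ℂ⟦X⟧)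
    (hp : p.map constantCoeff = Polynomial.X ^ (k + 1))
    (hq : q.map constantCoeff = Polynomial.X ^ (k + 1))
    (hp' : ∀ i, k ≤ i → p.coeff i = if i = k + 1 then 1 else 0)
    (hq' : ∀ i, k ≤ i → q.coeff i = if i = k + 1 then 1 else 0)
    (A B : ℂ⟦X⟧) (φ : ℂ⟦X⟧⟦X⟧) (ν : ℂ) (hν : ν ≠ 0)
    (hφ0 : constantCoeff (coeff 0 φ) = 0) (hφ1 : constantCoeff (coeff 1 φ) = ν)
    (h : derivative ℂ⟦X⟧ φ * p.eval₂ C X * (1 + C B * φ ^ k)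
      = q.eval₂ C φ * (1 + C A * X ^ k)) :
    ν ^ k = 1 ∧ (∀ i, C ν * p.coeff i = C (ν ^ i) * q.coeff i) ∧ A = B := by
  have hνk : ν ^ k = 1 := by
    have h' := congrArg (map constantCoeff : ℂ⟦X⟧⟦X⟧ →+* ℂ⟦X⟧) h
    simp only [map_mul, map_add, map_one, map_pow, map_C, map_X, map_constantCoeff_derivative,
      map_constantCoeff_eval₂, hp, hq, Polynomial.eval₂_X_pow] at h'
    obtain ⟨g, hg⟩ : X ∣ map constantCoeff φ := by
      rw [X_dvd_iff, ← coeff_zero_eq_constantCoeff_apply, coeff_map, hφ0]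
    have hg0 : constantCoeff g = ν := by
      rw [← hφ1, ← coeff_map, hg, show (1 : ℕ) = 0 + 1 from rfl, coeff_succ_X_mul,
        coeff_zero_eq_constantCoeff_apply]
    have E : (g + X * derivative ℂ g) * (1 + C (constantCoeff B) * X ^ k * g ^ k)
        = g ^ (k + 1) * (1 + C (constantCoeff A) * X ^ k) := by
      apply mul_left_cancel₀ (pow_ne_zero (k + 1) X_ne_zero)
      rw [hg, derivative_mul', derivative_X] at h'
      linear_combination h'
    have h1 := congrArg constantCoeff E
    simp only [map_add, map_mul, map_pow, constantCoeff_X, constantCoeff_one, zero_mul, mul_zero,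
      zero_pow (by omega : k ≠ 0), add_zero, hg0, mul_one] at h1
    apply mul_left_cancel₀ hν
    linear_combination -h1
  have hCν : (C (C ν⁻¹) * C (C ν) : ℂ⟦X⟧⟦X⟧) = 1 := by
    rw [← map_mul, ← map_mul, inv_mul_cancel₀ hν, map_one, map_one]
  have hcoeff (i : ℕ) : (Polynomial.C (C ν⁻¹) * q.comp (Polynomial.C (C ν) * Polynomial.X)).coeff i
      = C (ν⁻¹ * ν ^ i) * q.coeff i := by
    rw [Polynomial.coeff_C_mul, Polynomial.comp_C_mul_X_coeff, map_mul, map_pow]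
    ring
  obtain ⟨hpq, hAB⟩ := formal_conj_rigid k hk p
    (Polynomial.C (C ν⁻¹) * q.comp (Polynomial.C (C ν) * Polynomial.X))
    (fun i hi => by
      rw [hcoeff, hp' i hi, hq' i hi]
      split_ifs with h1
      · rw [h1, pow_succ, hνk, one_mul, inv_mul_cancel₀ hν, map_one, one_mul]
      · rw [mul_zero])
    hp
    (by
      rw [Polynomial.map_mul, Polynomial.map_comp, hq]
      simp only [Polynomial.map_C, Polynomial.map_mul, Polynomial.map_X, constantCoeff_C,
        Polynomial.pow_comp, Polynomial.X_comp]
      rw [mul_pow, ← mul_assoc, ← map_pow, ← map_mul, pow_succ, hνk, one_mul,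
        inv_mul_cancel₀ hν, map_one, one_mul])
    A B (C (C ν⁻¹) * φ)
    (by rw [coeff_C_mul, map_mul, hφ0, mul_zero])
    (by rw [coeff_C_mul, map_mul, hφ1, constantCoeff_C, inv_mul_cancel₀ hν])
    (by
      have h1 : (Polynomial.C (C ν⁻¹) * q.comp (Polynomial.C (C ν) * Polynomial.X)).eval₂ C
          (C (C ν⁻¹) * φ) = C (C ν⁻¹) * q.eval₂ C φ := by
        rw [Polynomial.eval₂_mul, Polynomial.eval₂_C, Polynomial.eval₂_comp, Polynomial.eval₂_mul,
          Polynomial.eval₂_C, Polynomial.eval₂_X, ← mul_assoc, mul_comm (C (C ν)), hCν, one_mul]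
      have h2 : (C (C ν⁻¹) : ℂ⟦X⟧⟦X⟧) ^ k = 1 := by
        rw [← map_pow, ← map_pow, inv_pow, hνk, inv_one, map_one, map_one]
      rw [h1, derivative_mul', derivative_C, mul_pow, h2]
      linear_combination C (C ν⁻¹) * h)
  refine ⟨hνk, fun i => ?_, hAB⟩
  conv_lhs => rw [hpq]
  rw [hcoeff, ← mul_assoc, ← map_mul, mul_inv_cancel_left₀ hν]

/-- The Taylor series at `0` of a function of one variable. -/
noncomputable def taylorOne (f : ℂ → ℂ) : PowerSeries ℂ :=
  PowerSeries.mk fun n => iteratedDeriv n f 0 / n.factorial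

theorem taylorOne_congr {f g : ℂ → ℂ} (h : f =ᶠ[nhds 0] g) : taylorOne f = taylorOne g := by
  ext n
  rw [taylorOne, taylorOne, PowerSeries.coeff_mk, PowerSeries.coeff_mk, h.iteratedDeriv_eq]

theorem taylorOne_add {f g : ℂ → ℂ} (hf : AnalyticAt ℂ f 0) (hg : AnalyticAt ℂ g 0) :
    taylorOne (fun z => f z + g z) = taylorOne f + taylorOne g := by
  ext n
  simp only [taylorOne, map_add, PowerSeries.coeff_mk]
  rw [iteratedDeriv_fun_add hf.contDiffAt hg.contDiffAt, add_div]

theorem taylorOne_mul {f g : ℂ → ℂ} (hf : AnalyticAt ℂ f 0) (hg : AnalyticAt ℂ g 0) :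
    taylorOne (fun z => f z * g z) = taylorOne f * taylorOne g := by
  ext n
  rw [PowerSeries.coeff_mul, Finset.Nat.sum_antidiagonal_eq_sum_range_succ_mk]
  simp only [taylorOne, PowerSeries.coeff_mk]
  rw [iteratedDeriv_fun_mul hf.contDiffAt hg.contDiffAt, Finset.sum_div]
  refine Finset.sum_congr rfl fun i hi => ?_
  have hi' : i ≤ n := Nat.lt_succ_iff.1 (Finset.mem_range.1 hi)
  rw [Nat.cast_choose ℂ hi']
  have h1 : (n.factorial : ℂ) ≠ 0 := Nat.cast_ne_zero.2 n.factorial_ne_zero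
  have h2 : (i.factorial : ℂ) ≠ 0 := Nat.cast_ne_zero.2 i.factorial_ne_zero
  have h3 : ((n - i).factorial : ℂ) ≠ 0 := Nat.cast_ne_zero.2 (n - i).factorial_ne_zero
  field_simp

theorem taylorOne_const (a : ℂ) : taylorOne (fun _ => a) = PowerSeries.C a := by
  ext n
  rw [taylorOne, PowerSeries.coeff_mk, iteratedDeriv_const, PowerSeries.coeff_C]
  split_ifs with h <;> simp [h]

theorem taylorOne_id : taylorOne (fun z => z) = PowerSeries.X := by
  ext n
  rw [taylorOne, PowerSeries.coeff_mk, iteratedDeriv_fun_id_zero, PowerSeries.coeff_X]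
  split_ifs with h <;> simp [h]

theorem constantCoeff_taylorOne (f : ℂ → ℂ) : PowerSeries.constantCoeff (taylorOne f) = f 0 := by
  rw [← PowerSeries.coeff_zero_eq_constantCoeff_apply, taylorOne, PowerSeries.coeff_mk]
  simp

theorem taylorOne_const_mul (a : ℂ) (f : ℂ → ℂ) :
    taylorOne (fun z => a * f z) = PowerSeries.C a * taylorOne f := by
  ext n
  rw [PowerSeries.coeff_C_mul, taylorOne, taylorOne, PowerSeries.coeff_mk, PowerSeries.coeff_mk,
    iteratedDeriv_const_mul_field, mul_div_assoc]

theorem taylorOne_sum {ι : Type*} (s : Finset ι) (f : ι → ℂ → ℂ)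
    (hf : ∀ i ∈ s, AnalyticAt ℂ (f i) 0) :
    taylorOne (fun z => ∑ i ∈ s, f i z) = ∑ i ∈ s, taylorOne (f i) := by
  classical
  induction s using Finset.induction_on with
  | empty => simpa using taylorOne_const 0
  | insert a s ha ih =>
    simp only [Finset.sum_insert ha]
    rw [taylorOne_add (hf a (Finset.mem_insert_self a s))
      (Finset.analyticAt_fun_sum s fun i hi => hf i (Finset.mem_insert_of_mem hi)),
      ih fun i hi => hf i (Finset.mem_insert_of_mem hi)]

theorem eventuallyEq_of_taylorOne_eq {f g : ℂ → ℂ} (hf : AnalyticAt ℂ f 0)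
    (hg : AnalyticAt ℂ g 0) (h : taylorOne f = taylorOne g) : f =ᶠ[nhds 0] g := by
  have h0 : taylorOne (fun z => f z + (-1) * g z) = 0 := by
    rw [taylorOne_add hf (analyticAt_const.fun_mul hg), taylorOne_const_mul, h]
    simp
  have hfg : AnalyticAt ℂ (fun z => f z + (-1) * g z) 0 := hf.fun_add (analyticAt_const.fun_mul hg)
  have htop : analyticOrderAt (fun z => f z + (-1) * g z) 0 = ⊤ := by
    refine ENat.eq_top_iff_forall_ge.2 fun n => ?_
    rw [natCast_le_analyticOrderAt_iff_iteratedDeriv_eq_zero hfg]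
    intro i _
    have h1 := congrArg (PowerSeries.coeff i) h0
    rw [taylorOne, PowerSeries.coeff_mk, map_zero] at h1
    exact (div_eq_zero_iff.1 h1).resolve_right (Nat.cast_ne_zero.2 i.factorial_ne_zero)
  filter_upwards [analyticOrderAt_eq_top.1 htop] with z hz
  linear_combination hz

/-- The partial derivative with respect to the first variable. -/
noncomputable def derivFst (f : ℂ × ℂ → ℂ) : ℂ × ℂ → ℂ :=
  fun p => deriv (fun z => f (z, p.2)) p.1

theorem AnalyticAt.derivFst {f : ℂ × ℂ → ℂ} {p : ℂ × ℂ} (hf : AnalyticAt ℂ f p) :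
    AnalyticAt ℂ (derivFst f) p := by
  have h1 : AnalyticAt ℂ (fun x => fderiv ℂ f x (1, 0)) p :=
    AnalyticAt.fun_comp ((ContinuousLinearMap.apply ℂ ℂ ((1 : ℂ), (0 : ℂ))).analyticAt _) hf.fderiv
  refine h1.congr ?_
  filter_upwards [hf.eventually_analyticAt] with x hx
  have h2 : HasDerivAt (fun z : ℂ => (z, x.2)) ((1 : ℂ), (0 : ℂ)) x.1 :=
    (hasDerivAt_id x.1).prodMk (hasDerivAt_const x.1 x.2)
  have h3 : HasFDerivAt f (fderiv ℂ f x) (x.1, x.2) := hx.differentiableAt.hasFDerivAt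
  exact (h3.comp_hasDerivAt x.1 h2).deriv.symm

theorem iterate_derivFst (f : ℂ × ℂ → ℂ) (m : ℕ) (z ε : ℂ) :
    derivFst^[m] f (z, ε) = iteratedDeriv m (fun z => f (z, ε)) z := by
  induction m generalizing f with
  | zero => simp
  | succ m ih =>
    rw [Function.iterate_succ_apply, ih, iteratedDeriv_succ']
    rfl

theorem AnalyticAt.slice {f : ℂ × ℂ → ℂ} {z ε : ℂ} (hf : AnalyticAt ℂ f (z, ε)) :
    AnalyticAt ℂ (fun z => f (z, ε)) z :=
  AnalyticAt.fun_comp (g := f) (f := fun z => (z, ε)) hf (analyticAt_id.prod analyticAt_const)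

theorem eventually_slice {P : ℂ × ℂ → Prop} (h : ∀ᶠ p in nhds (0, 0), P p) :
    ∀ᶠ ε in nhds (0 : ℂ), P (0, ε) :=
  ((Continuous.prodMk_right (0 : ℂ)).tendsto (0 : ℂ)).eventually h

theorem analyticAt_coeff_taylorOne {f : ℂ × ℂ → ℂ} (hf : AnalyticAt ℂ f (0, 0)) (m : ℕ) :
    AnalyticAt ℂ (fun ε => PowerSeries.coeff m (taylorOne fun z => f (z, ε))) 0 := by
  have h1 : AnalyticAt ℂ (derivFst^[m] f) (0, 0) := by
    induction m generalizing f with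
    | zero => exact hf
    | succ m ih => exact ih hf.derivFst
  have h2 : AnalyticAt ℂ (fun ε => derivFst^[m] f (0, ε)) 0 :=
    AnalyticAt.fun_comp (g := derivFst^[m] f) (f := fun ε => (0, ε)) h1
      (analyticAt_const.prod analyticAt_id)
  simp only [taylorOne, PowerSeries.coeff_mk]
  simp only [iterate_derivFst] at h2
  exact h2.div_const

/-- The Taylor series at `(0, 0)` of a function of `(z, ε)`, as a power series in `z` whose
coefficients are power series in `ε`. -/
noncomputable def taylorTwo (f : ℂ × ℂ → ℂ) : PowerSeries (PowerSeries ℂ) :=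
  PowerSeries.mk fun m =>
    taylorOne fun ε => PowerSeries.coeff m (taylorOne fun z => f (z, ε))

theorem taylorTwo_congr {f g : ℂ × ℂ → ℂ} (h : f =ᶠ[nhds (0, 0)] g) :
    taylorTwo f = taylorTwo g := by
  ext1 m
  rw [taylorTwo, taylorTwo, PowerSeries.coeff_mk, PowerSeries.coeff_mk]
  apply taylorOne_congr
  filter_upwards [eventually_slice h.eventuallyEq_nhds] with ε hε
  rw [taylorOne_congr (f := fun z => f (z, ε)) (g := fun z => g (z, ε))
    (((Continuous.prodMk_left ε).tendsto (0 : ℂ)).eventually hε)]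

theorem taylorTwo_add {f g : ℂ × ℂ → ℂ} (hf : AnalyticAt ℂ f (0, 0))
    (hg : AnalyticAt ℂ g (0, 0)) :
    taylorTwo (fun p => f p + g p) = taylorTwo f + taylorTwo g := by
  ext1 m
  simp only [taylorTwo, map_add, PowerSeries.coeff_mk]
  rw [← taylorOne_add (analyticAt_coeff_taylorOne hf m) (analyticAt_coeff_taylorOne hg m)]
  apply taylorOne_congr
  filter_upwards [eventually_slice hf.eventually_analyticAt,
    eventually_slice hg.eventually_analyticAt] with ε h1 h2
  rw [taylorOne_add h1.slice h2.slice, map_add]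

theorem taylorTwo_mul {f g : ℂ × ℂ → ℂ} (hf : AnalyticAt ℂ f (0, 0))
    (hg : AnalyticAt ℂ g (0, 0)) :
    taylorTwo (fun p => f p * g p) = taylorTwo f * taylorTwo g := by
  ext1 m
  rw [PowerSeries.coeff_mul]
  simp only [taylorTwo, PowerSeries.coeff_mk]
  simp_rw [← taylorOne_mul (analyticAt_coeff_taylorOne hf _) (analyticAt_coeff_taylorOne hg _)]
  rw [← taylorOne_sum _ _ fun i _ =>
    (analyticAt_coeff_taylorOne hf _).fun_mul (analyticAt_coeff_taylorOne hg _)]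
  apply taylorOne_congr
  filter_upwards [eventually_slice hf.eventually_analyticAt,
    eventually_slice hg.eventually_analyticAt] with ε h1 h2
  rw [taylorOne_mul h1.slice h2.slice, PowerSeries.coeff_mul]

theorem taylorTwo_snd (a : ℂ → ℂ) : taylorTwo (fun p => a p.2) = PowerSeries.C (taylorOne a) := by
  ext1 m
  rw [taylorTwo, PowerSeries.coeff_mk, PowerSeries.coeff_C]
  simp only [taylorOne_const, PowerSeries.coeff_C]
  split_ifs with h
  · rfl
  · simpa using taylorOne_const 0

theorem taylorTwo_fst : taylorTwo (fun p => p.1) = PowerSeries.X := by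
  ext1 m
  rw [taylorTwo, PowerSeries.coeff_mk, PowerSeries.coeff_X]
  simp only [taylorOne_id, PowerSeries.coeff_X, taylorOne_const]
  split_ifs with h <;> simp

theorem taylorTwo_one : taylorTwo (fun _ => 1) = 1 := by
  rw [taylorTwo_snd fun _ => 1, taylorOne_const, map_one, map_one]

theorem taylorTwo_pow {f : ℂ × ℂ → ℂ} (hf : AnalyticAt ℂ f (0, 0)) (n : ℕ) :
    taylorTwo (fun p => f p ^ n) = taylorTwo f ^ n := by
  induction n with
  | zero => simpa using taylorTwo_one
  | succ n ih =>
    simp only [pow_succ]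
    rw [taylorTwo_mul (hf.fun_pow n) hf, ih]

theorem taylorTwo_sum {ι : Type*} (s : Finset ι) (f : ι → ℂ × ℂ → ℂ)
    (hf : ∀ i ∈ s, AnalyticAt ℂ (f i) (0, 0)) :
    taylorTwo (fun z => ∑ i ∈ s, f i z) = ∑ i ∈ s, taylorTwo (f i) := by
  classical
  induction s using Finset.induction_on with
  | empty => simpa [taylorOne_const] using taylorTwo_snd fun _ => 0
  | insert a s ha ih =>
    simp only [Finset.sum_insert ha]
    rw [taylorTwo_add (hf a (Finset.mem_insert_self a s))
      (Finset.analyticAt_fun_sum s fun i hi => hf i (Finset.mem_insert_of_mem hi)),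
      ih fun i hi => hf i (Finset.mem_insert_of_mem hi)]

theorem taylorTwo_derivFst (f : ℂ × ℂ → ℂ) :
    taylorTwo (derivFst f) = PowerSeries.derivative _ (taylorTwo f) := by
  ext1 m
  rw [PowerSeries.coeff_derivative, taylorTwo, taylorTwo, PowerSeries.coeff_mk,
    PowerSeries.coeff_mk]
  have h1 (ε : ℂ) : PowerSeries.coeff m (taylorOne fun z => derivFst f (z, ε))
      = ((m : ℂ) + 1) * PowerSeries.coeff (m + 1) (taylorOne fun z => f (z, ε)) := by
    rw [taylorOne, taylorOne, PowerSeries.coeff_mk, PowerSeries.coeff_mk, iteratedDeriv_succ',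
      Nat.factorial_succ]
    have h2 : (m.factorial : ℂ) ≠ 0 := Nat.cast_ne_zero.2 m.factorial_ne_zero
    have h3 : (m : ℂ) + 1 ≠ 0 := Nat.cast_add_one_ne_zero m
    push_cast
    field_simp
    rfl
  simp only [h1]
  rw [taylorOne_const_mul, mul_comm]
  simp

theorem AnalyticAt.comp_snd {a : ℂ → ℂ} (ha : AnalyticAt ℂ a 0) :
    AnalyticAt ℂ (fun p : ℂ × ℂ => a p.2) (0, 0) :=
  AnalyticAt.fun_comp (g := a) (f := Prod.snd) (x := ((0 : ℂ), (0 : ℂ))) ha analyticAt_snd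

/-- The polynomial in `z` with power series coefficients attached to `kostovP`. -/
noncomputable def formalKostov (k : ℕ) (c : ℕ → PowerSeries ℂ) (t : PowerSeries ℂ) :
    Polynomial (PowerSeries ℂ) :=
  Polynomial.X ^ (k + 1) + (∑ j ∈ Finset.Icc 1 (k - 1), Polynomial.C (c j) * Polynomial.X ^ j)
    - Polynomial.C t

theorem coeff_formalKostov (k : ℕ) (c : ℕ → PowerSeries ℂ) (t : PowerSeries ℂ) (i : ℕ) :
    (formalKostov k c t).coeff i = (if i = k + 1 then 1 else 0)
      + (if i ∈ Finset.Icc 1 (k - 1) then c i else 0) - if i = 0 then t else 0 := by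
  rw [formalKostov, Polynomial.coeff_sub, Polynomial.coeff_add, Polynomial.coeff_X_pow,
    Polynomial.finsetSum_coeff, Polynomial.coeff_C]
  simp only [Polynomial.coeff_C_mul, Polynomial.coeff_X_pow, mul_ite, mul_one, mul_zero,
    Finset.sum_ite_eq]

theorem coeff_formalKostov_of_le {k : ℕ} (hk : 1 ≤ k) (c : ℕ → PowerSeries ℂ)
    (t : PowerSeries ℂ) (i : ℕ) (hi : k ≤ i) :
    (formalKostov k c t).coeff i = if i = k + 1 then 1 else 0 := by
  rw [coeff_formalKostov, if_neg (by omega : i ≠ 0), sub_zero,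
    if_neg (c := i ∈ Finset.Icc 1 (k - 1)) (by rw [Finset.mem_Icc]; omega), add_zero]

theorem map_formalKostov (k : ℕ) (c : ℕ → PowerSeries ℂ) (t : PowerSeries ℂ)
    (hc : ∀ j ∈ Finset.Icc 1 (k - 1), PowerSeries.constantCoeff (c j) = 0)
    (ht : PowerSeries.constantCoeff t = 0) :
    (formalKostov k c t).map PowerSeries.constantCoeff = Polynomial.X ^ (k + 1) := by
  rw [formalKostov, Polynomial.map_sub, Polynomial.map_add, Polynomial.map_sum,
    Finset.sum_eq_zero fun j hj => ?_]
  · simp [ht]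
  · simp [hc j hj]

theorem taylorTwo_kostovP (k : ℕ) (c : ℕ → ℂ → ℂ)
    (hc : ∀ j ∈ Finset.Icc 1 (k - 1), AnalyticAt ℂ (c j) 0) (F : ℂ × ℂ → ℂ)
    (hF : AnalyticAt ℂ F (0, 0)) (h : ℂ → ℂ) (hh : AnalyticAt ℂ h 0) (hh0 : h 0 = 0) :
    AnalyticAt ℂ (fun p : ℂ × ℂ => kostovP k c (F p) (h p.2)) (0, 0) ∧
    taylorTwo (fun p => kostovP k c (F p) (h p.2))
      = (formalKostov k (fun j => taylorOne fun ε => c j (h ε)) (taylorOne h)).eval₂ PowerSeries.C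
        (taylorTwo F) := by
  have hch (j) (hj : j ∈ Finset.Icc 1 (k - 1)) : AnalyticAt ℂ (fun ε => c j (h ε)) 0 :=
    AnalyticAt.fun_comp (g := c j) (f := h) (by rw [hh0]; exact hc j hj) hh
  have hterm (j) (hj : j ∈ Finset.Icc 1 (k - 1)) :
      AnalyticAt ℂ (fun p : ℂ × ℂ => c j (h p.2) * F p ^ j) (0, 0) :=
    (hch j hj).comp_snd.fun_mul (hF.fun_pow j)
  have hs : AnalyticAt ℂ (fun p : ℂ × ℂ => ∑ j ∈ Finset.Icc 1 (k - 1), c j (h p.2) * F p ^ j)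
      (0, 0) := Finset.analyticAt_fun_sum _ hterm
  have hneg : AnalyticAt ℂ (fun ε => (-1) * h ε) 0 := analyticAt_const.fun_mul hh
  have hP : (fun p : ℂ × ℂ => kostovP k c (F p) (h p.2)) = fun p => (F p ^ (k + 1)
      + ∑ j ∈ Finset.Icc 1 (k - 1), c j (h p.2) * F p ^ j) + (fun ε => (-1) * h ε) p.2 := by
    funext p
    rw [kostovP]
    ring
  rw [hP]
  refine ⟨((hF.fun_pow _).add hs).add hneg.comp_snd, ?_⟩
  rw [taylorTwo_add ((hF.fun_pow _).fun_add hs) hneg.comp_snd, taylorTwo_add (hF.fun_pow _) hs,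
    taylorTwo_pow hF, taylorTwo_sum _ _ hterm, taylorTwo_snd fun ε => (-1) * h ε, taylorOne_const_mul, formalKostov,
    Polynomial.eval₂_sub, Polynomial.eval₂_add, Polynomial.eval₂_X_pow,
    Polynomial.eval₂_finsetSum, Polynomial.eval₂_C, sub_eq_add_neg]
  congr 1
  · congr 1
    refine Finset.sum_congr rfl fun j hj => ?_
    rw [taylorTwo_mul (hch j hj).comp_snd (hF.fun_pow j), taylorTwo_pow hF,
      taylorTwo_snd fun ε => c j (h ε), Polynomial.eval₂_mul, Polynomial.eval₂_C,
      Polynomial.eval₂_X_pow]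
  · simp

/-- If two Kostov-type normal forms `P_ε(z)/(1+A(ε)z^k)` and
`P̃_ε(z)/(1+Ã(ε)z^k)` (monic centered, constant term `−ε`, coefficients vanishing at
`ε = 0`) are conjugate by an analytic change of coordinate and parameter `(φ, h)`, then
for some `k`-th root of unity `ν`: `h(ε) = ν·ε`, `A(ε) = Ã(ν·ε)` and
`P̃(ν·z, ν·ε) = ν·P(z, ε)` near the origin — the parameter is canonical, unique up to a
`k`-th root of unity. -/
theorem statement16 (k : ℕ) (hk : 1 ≤ k)
    (b c : ℕ → ℂ → ℂ) (A At : ℂ → ℂ)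
    (hb : ∀ j ∈ Finset.Icc 1 (k - 1), AnalyticAt ℂ (b j) 0 ∧ b j 0 = 0)
    (hc : ∀ j ∈ Finset.Icc 1 (k - 1), AnalyticAt ℂ (c j) 0 ∧ c j 0 = 0)
    (hA : AnalyticAt ℂ A 0) (hAt : AnalyticAt ℂ At 0)
    (φ : ℂ → ℂ → ℂ) (h : ℂ → ℂ)
    (hφ : AnalyticAt ℂ (fun p : ℂ × ℂ => φ p.1 p.2) (0, 0))
    (hφ0 : φ 0 0 = 0) (hφ' : deriv (fun z => φ z 0) 0 ≠ 0)
    (hφinj : ∃ r ρ : ℝ, 0 < r ∧ 0 < ρ ∧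
      ∀ ε ∈ ball (0 : ℂ) ρ, Set.InjOn (fun z => φ z ε) (ball 0 r))
    (hh : AnalyticAt ℂ h 0) (hh0 : h 0 = 0) (hh' : deriv h 0 ≠ 0)
    (hconj : ∀ᶠ p : ℂ × ℂ in nhds (0, 0),
      deriv (fun z => φ z p.2) p.1 * (kostovP k b p.1 p.2 / (1 + A p.2 * p.1 ^ k))
        = kostovP k c (φ p.1 p.2) (h p.2) / (1 + At (h p.2) * φ p.1 p.2 ^ k)) :
    ∃ ν : ℂ, ν ^ k = 1 ∧
      (∀ᶠ ε in nhds (0 : ℂ), h ε = ν * ε) ∧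
      (∀ᶠ ε in nhds (0 : ℂ), A ε = At (ν * ε)) ∧
      (∀ᶠ p : ℂ × ℂ in nhds (0, 0),
        kostovP k c (ν * p.1) (ν * p.2) = ν * kostovP k b p.1 p.2) := by
  obtain ⟨Φ, hΦdef⟩ : ∃ Φ : ℂ × ℂ → ℂ, Φ = fun p => φ p.1 p.2 := ⟨_, rfl⟩
  have hΦ : AnalyticAt ℂ Φ (0, 0) := hΦdef ▸ hφ
  have hΦ0 : Φ (0, 0) = 0 := by rw [hΦdef]; exact hφ0
  have hAth : AnalyticAt ℂ (fun ε => At (h ε)) 0 :=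
    AnalyticAt.fun_comp (g := At) (f := h) (by rw [hh0]; exact hAt) hh
  have hk0 : k ≠ 0 := by omega
  have hden₁ : AnalyticAt ℂ (fun p : ℂ × ℂ => 1 + A p.2 * p.1 ^ k) (0, 0) :=
    analyticAt_const.fun_add (hA.comp_snd.fun_mul (analyticAt_fst.fun_pow k))
  have hden₂ : AnalyticAt ℂ (fun p : ℂ × ℂ => 1 + (fun ε => At (h ε)) p.2 * Φ p ^ k) (0, 0) :=
    analyticAt_const.fun_add (hAth.comp_snd.fun_mul (hΦ.fun_pow k))
  have hne₁ := hden₁.continuousAt.eventually_ne (y := 0) (by simp [hk0])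
  have hne₂ := hden₂.continuousAt.eventually_ne (y := 0) (by simp [hk0, hΦ0])
  obtain ⟨hPan, hPt⟩ := taylorTwo_kostovP k b (fun j hj => (hb j hj).1) (fun p => p.1)
    analyticAt_fst (fun ε => ε) analyticAt_id rfl
  obtain ⟨hQan, hQt⟩ := taylorTwo_kostovP k c (fun j hj => (hc j hj).1) Φ hΦ h hh hh0
  have hcross : (fun p : ℂ × ℂ => derivFst Φ p * kostovP k b p.1 p.2
        * (1 + (fun ε => At (h ε)) p.2 * Φ p ^ k))
      =ᶠ[nhds (0, 0)] fun p => kostovP k c (Φ p) (h p.2) * (1 + A p.2 * p.1 ^ k) := by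
    filter_upwards [hconj, hne₁, hne₂] with p h1 h2 h3
    have h4 : derivFst Φ p = deriv (fun z => φ z p.2) p.1 := by rw [hΦdef]; rfl
    have h5 : Φ p = φ p.1 p.2 := by rw [hΦdef]
    rw [h5] at h3
    rw [h4, h5]
    rwa [← mul_div_assoc, div_eq_div_iff h2 h3] at h1
  have hformal := taylorTwo_congr hcross
  rw [taylorTwo_mul (hΦ.derivFst.fun_mul hPan) hden₂, taylorTwo_mul hΦ.derivFst hPan,
    taylorTwo_mul hQan hden₁, taylorTwo_add analyticAt_const (hAth.comp_snd.fun_mul (hΦ.fun_pow k)),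
    taylorTwo_add analyticAt_const (hA.comp_snd.fun_mul (analyticAt_fst.fun_pow k)),
    taylorTwo_mul hAth.comp_snd (hΦ.fun_pow k), taylorTwo_mul hA.comp_snd (analyticAt_fst.fun_pow k),
    taylorTwo_pow hΦ, taylorTwo_pow analyticAt_fst, taylorTwo_snd A, taylorTwo_snd fun ε => At (h ε),
    taylorTwo_one, taylorTwo_fst, taylorTwo_derivFst, hPt, hQt, taylorTwo_fst] at hformal
  have hch (j) (hj : j ∈ Finset.Icc 1 (k - 1)) : AnalyticAt ℂ (fun ε => c j (h ε)) 0 :=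
    AnalyticAt.fun_comp (g := c j) (f := h) (by rw [hh0]; exact (hc j hj).1) hh
  obtain ⟨ν, hνdef⟩ : ∃ ν, ν = deriv (fun z => φ z 0) 0 := ⟨_, rfl⟩
  have hν : ν ≠ 0 := hνdef ▸ hφ'
  obtain ⟨hνk, hcoeff, hAB⟩ := formal_conj_classification k hk _ _
    (map_formalKostov k _ _ (fun j hj => by rw [constantCoeff_taylorOne]; exact (hb j hj).2)
      (constantCoeff_taylorOne _))
    (map_formalKostov k _ _
      (fun j hj => by rw [constantCoeff_taylorOne, hh0]; exact (hc j hj).2)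
      (by rw [constantCoeff_taylorOne, hh0]))
    (coeff_formalKostov_of_le hk _ _) (coeff_formalKostov_of_le hk _ _)
    (taylorOne A) (taylorOne fun ε => At (h ε)) (taylorTwo Φ) ν hν
    (by
      rw [taylorTwo, PowerSeries.coeff_mk, constantCoeff_taylorOne,
        PowerSeries.coeff_zero_eq_constantCoeff_apply, constantCoeff_taylorOne, hΦ0])
    (by
      rw [taylorTwo, PowerSeries.coeff_mk, constantCoeff_taylorOne, taylorOne,
        PowerSeries.coeff_mk, iteratedDeriv_one, Nat.factorial_one, Nat.cast_one, div_one, hνdef,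
        hΦdef])
    hformal
  have hhν : h =ᶠ[nhds 0] fun ε => ν * ε := by
    refine eventuallyEq_of_taylorOne_eq hh (analyticAt_const.fun_mul analyticAt_id) ?_
    have h0 := hcoeff 0
    simp only [coeff_formalKostov] at h0
    rw [taylorOne_const_mul]
    simpa using h0.symm
  have hcν : ∀ j ∈ Finset.Icc 1 (k - 1),
      ∀ᶠ ε in nhds (0 : ℂ), ν * b j ε = ν ^ j * c j (ν * ε) := by
    intro j hj
    have hj' := Finset.mem_Icc.1 hj
    have h1 := hcoeff j
    simp only [coeff_formalKostov, if_pos hj, if_neg (by omega : j ≠ 0),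
      if_neg (by omega : j ≠ k + 1), zero_add, sub_zero, ← taylorOne_const_mul] at h1
    filter_upwards [hhν, eventuallyEq_of_taylorOne_eq (analyticAt_const.fun_mul (hb j hj).1)
      (analyticAt_const.fun_mul (hch j hj)) h1] with ε h2 h3
    rw [h3, h2]
  refine ⟨ν, hνk, hhν, ?_, ?_⟩
  · filter_upwards [hhν, eventuallyEq_of_taylorOne_eq hA hAth hAB] with ε h1 h2
    rw [h2, h1]
  · have h1 : ∀ᶠ ε in nhds (0 : ℂ), ∀ j ∈ Finset.Icc 1 (k - 1),
        ν * b j ε = ν ^ j * c j (ν * ε) := (Filter.eventually_all_finset _).2 hcν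
    have h2 : Tendsto Prod.snd (nhds ((0 : ℂ), (0 : ℂ))) (nhds 0) :=
      continuous_snd.tendsto ((0 : ℂ), (0 : ℂ))
    filter_upwards [h2.eventually h1] with p hp
    rw [kostovP, kostovP, mul_sub, mul_add, Finset.mul_sum]
    congr 2
    · rw [mul_pow, pow_succ ν, hνk, one_mul]
    · refine Finset.sum_congr rfl fun j hj => ?_
      rw [mul_pow]
      linear_combination -p.1 ^ j * hp j hj
end

section
/- Let k ≥ 1 and let ω(z,ε) = (z^{k+1} − ε)·v(z,ε) be a factored family of codimension k with natural eigenvalue function λ. Then ω is conjugate, by an analytic change of coordinate and parameter, to the family ω̃(z,ε) = z^{k+1} − ε — i.e., there exist r, ρ > 0, an analytic map ψ : B(0,r) × B(0,ρ) → ℂ with ψ(0,0) = 0 and z ↦ ψ(z,ε) injective for each ε, and an analytic map h : B(0,ρ) → ℂ with h(0) = 0 and h'(0) ≠ 0, such that ∂ψ/∂z(z,ε)·ω(z,ε) = ψ(z,ε)^{k+1} − h(ε) on B(0,r) × B(0,ρ) — if and only if there exists an analytic function σ near 0 with σ(0) ≠ 0 such that λ(δ) = δ^k·σ(δ^{k+1})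 for all δ in a neighborhood of 0. -/
open Metric Set Filter Complex

/-- Averaging an analytic function along a continuous family of linear contractions gives an
analytic function. -/
theorem AnalyticAt.integral_comp_clm {E : Type*} [NormedAddCommGroup E] [NormedSpace ℂ E]
    {f : E → ℂ} (hf : AnalyticAt ℂ f 0) {M : ℝ → E →L[ℂ] E} (hM : Continuous M)
    (hM1 : ∀ τ ∈ uIoc (0 : ℝ) 1, ‖M τ‖ ≤ 1) :
    AnalyticAt ℂ (fun x => ∫ τ in (0 : ℝ)..1, f (M τ x)) 0 := by
  obtain ⟨p, r, hp⟩ := hf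
  obtain ⟨s, hs0, hsr⟩ := ENNReal.lt_iff_exists_nnreal_btwn.1 hp.r_pos
  have hsum : Summable fun n => ‖p n‖ * (s : ℝ) ^ n :=
    p.summable_norm_mul_pow (hsr.trans_le hp.r_le)
  set P : ℝ → (n : ℕ) → ContinuousMultilinearMap ℂ (fun _ : Fin n => E) ℂ :=
    fun τ n => (p n).compContinuousLinearMap (fun _ => M τ) with hP
  have hPc : ∀ n, Continuous fun τ => P τ n := by
    intro n
    have := (ContinuousMultilinearMap.compContinuousLinearMapContinuousMultilinear ℂ
      (fun _ : Fin n => E) (fun _ : Fin n => E) ℂ).cont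
    have h2 := this.comp (continuous_pi (fun _ : Fin n => hM))
    exact h2.clm_apply continuous_const
  have hPn : ∀ n, ∀ τ ∈ uIoc (0 : ℝ) 1, ‖P τ n‖ ≤ ‖p n‖ := by
    intro n τ hτ
    refine ((p n).norm_compContinuousLinearMap_le _).trans ?_
    refine mul_le_of_le_one_right (norm_nonneg _) ?_
    exact Finset.prod_le_one (fun _ _ => norm_nonneg _) (fun _ _ => hM1 τ hτ)
  set q : FormalMultilinearSeries ℂ E ℂ := fun n => ∫ τ in (0 : ℝ)..1, P τ n with hq
  have hqn : ∀ n, ‖q n‖ ≤ ‖p n‖ := by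
    intro n
    have := intervalIntegral.norm_integral_le_of_norm_le_const (hPn n)
    simpa using this
  refine ⟨q, s, ?_, by simpa using hs0, ?_⟩
  · refine q.le_radius_of_summable_norm ?_
    refine hsum.of_nonneg_of_le (fun n => by positivity) (fun n => ?_)
    gcongr
    exact hqn n
  · intro y hy
    rw [zero_add]
    have hy' : ‖y‖ < s := by simpa [← NNReal.coe_lt_coe] using hy
    have happ : ∀ n, q n (fun _ => y) = ∫ τ in (0 : ℝ)..1, p n (fun _ => M τ y) := by
      intro n
      have := ((ContinuousMultilinearMap.apply ℂ (fun _ : Fin n => E) ℂ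
        (fun _ => y))).intervalIntegral_comp_comm ((hPc n).intervalIntegrable (μ := MeasureTheory.volume) 0 1)
      exact this.symm
    simp_rw [happ]
    have hMy : ∀ τ ∈ uIoc (0 : ℝ) 1, ‖M τ y‖ ≤ ‖y‖ := fun τ hτ =>
      ((M τ).le_opNorm y).trans (mul_le_of_le_one_left (norm_nonneg _) (hM1 τ hτ))
    refine intervalIntegral.hasSum_integral_of_dominated_convergence
      (fun n _ => ‖p n‖ * (s : ℝ) ^ n) ?_ ?_ ?_ ?_ ?_
    · intro n
      refine Continuous.aestronglyMeasurable ?_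
      have := (hM.clm_apply (continuous_const (y := y)))
      fun_prop
    · intro n
      refine Eventually.of_forall fun τ hτ => ?_
      refine ((p n).le_opNorm _).trans ?_
      simp only [Finset.prod_const, Finset.card_univ, Fintype.card_fin]
      gcongr
      exact (hMy τ hτ).trans hy'.le
    · exact Eventually.of_forall fun τ hτ => hsum
    · exact intervalIntegrable_const
    · refine Eventually.of_forall fun τ hτ => ?_
      have := hp.hasSum (y := M τ y) (by
        have : (‖M τ y‖ₑ) < r := by
          refine lt_of_le_of_lt ?_ hsr
          rw [← ofReal_norm, ← ENNReal.ofReal_coe_nnreal]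
          exact ENNReal.ofReal_le_ofReal ((hMy τ hτ).trans hy'.le)
        simpa using this)
      simpa using this

/-- Averaging an analytic function over the segments `{p.1} × [0, p.2]`. -/
theorem AnalyticAt.integral_comp_mul_snd {E : Type*} [NormedAddCommGroup E] [NormedSpace ℂ E]
    {f : E × ℂ → ℂ} (hf : AnalyticAt ℂ f 0) :
    AnalyticAt ℂ (fun p : E × ℂ => ∫ τ in (0 : ℝ)..1, f (p.1, (τ : ℂ) * p.2)) 0 := by
  have := hf.integral_comp_clm
    (M := fun τ : ℝ => (ContinuousLinearMap.fst ℂ E ℂ).prod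
      ((τ : ℂ) • ContinuousLinearMap.snd ℂ E ℂ)) ?_ ?_
  · simpa using this
  · have h : Continuous fun τ : ℝ => ((τ : ℂ) • ContinuousLinearMap.snd ℂ E ℂ) := by fun_prop
    exact (ContinuousLinearMap.prodₗᵢ (𝕜 := ℂ) (E := E × ℂ) (F := E) (G := ℂ) ℂ).continuous.comp
      ((continuous_const (y := ContinuousLinearMap.fst ℂ E ℂ)).prodMk h)
  · intro τ hτ
    rw [uIoc_of_le zero_le_one] at hτ
    refine ContinuousLinearMap.opNorm_le_bound _ zero_le_one fun x => ?_
    rw [one_mul]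
    refine max_le (norm_fst_le x) ?_
    have h1 : ‖(τ : ℂ)‖ ≤ 1 := by
      rw [Complex.norm_real, Real.norm_eq_abs, abs_of_pos hτ.1]; exact hτ.2
    have : ‖(τ : ℂ) * x.2‖ ≤ ‖x‖ := by
      rw [norm_mul]
      exact (mul_le_of_le_one_left (norm_nonneg _) h1).trans (norm_snd_le x)
    simpa using this

/-- Integral of the derivative along the segment from `a` to `a + w`. -/
theorem mul_integral_segment {N f : ℂ → ℂ} {c a w : ℂ} {R : ℝ}
    (hN : ∀ z ∈ ball c R, HasDerivAt N (f z) z) (hf : ContinuousOn f (ball c R))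
    (ha : a ∈ ball c R) (haw : a + w ∈ ball c R) :
    w * ∫ τ in (0 : ℝ)..1, f (a + τ * w) = N (a + w) - N a := by
  have hmem : ∀ τ ∈ Icc (0 : ℝ) 1, a + τ * w ∈ ball c R := by
    intro τ hτ
    have := (convex_ball c R).add_smul_sub_mem ha haw hτ
    simpa using this
  have hc : ContinuousOn (fun τ : ℝ => w * f (a + τ * w)) (Icc 0 1) := by
    refine continuousOn_const.mul (hf.comp (by fun_prop) hmem)
  have := intervalIntegral.integral_eq_sub_of_hasDerivAt (a := 0) (b := 1)
    (f := fun τ : ℝ => N (a + τ * w)) (f' := fun τ : ℝ => w * f (a + τ * w)) ?_ ?_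
  · simpa using this
  · intro τ hτ
    rw [uIcc_of_le zero_le_one] at hτ
    have h1 : HasDerivAt (fun τ : ℝ => a + (τ : ℂ) * w) w τ := by
      have := ((Complex.ofRealCLM.hasDerivAt (x := τ)).mul_const w).const_add a
      simpa using this
    have h2 := (hN _ (hmem τ hτ)).scomp τ h1
    simpa [Function.comp_def] using h2
  · refine ContinuousOn.intervalIntegrable ?_
    rwa [uIcc_of_le zero_le_one]

/-- An analytic function vanishing on `{u = 0}` is divisible by `u`. -/
theorem AnalyticAt.exists_eq_snd_mul {V : ℂ × ℂ → ℂ} (hV : AnalyticAt ℂ V 0)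
    (h0 : ∀ᶠ z in nhds (0 : ℂ), V (z, 0) = 0) :
    ∃ W : ℂ × ℂ → ℂ, AnalyticAt ℂ W 0 ∧ ∀ᶠ p in nhds (0 : ℂ × ℂ), V p = p.2 * W p := by
  have hd : AnalyticAt ℂ (fun p => fderiv ℂ V p (0, 1)) 0 := 
    ((ContinuousLinearMap.apply ℂ ℂ ((0 : ℂ), (1 : ℂ))).analyticAt _).comp hV.fderiv
  refine ⟨_, hd.integral_comp_mul_snd, ?_⟩
  obtain ⟨r, hr, hball⟩ := Metric.eventually_nhds_iff_ball.1 hV.eventually_analyticAt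
  have h0' := (continuous_fst (X := ℂ) (Y := ℂ)).tendsto (0 : ℂ × ℂ) |>.eventually h0
  filter_upwards [h0', ball_mem_nhds (0 : ℂ × ℂ) hr] with p hp0 hp
  have hp' : p.1 ∈ ball (0 : ℂ) r ∧ p.2 ∈ ball (0 : ℂ) r := by
    rwa [← Prod.mk_zero_zero, ← ball_prod_same, mem_prod] at hp
  have hmem : ∀ u ∈ ball (0 : ℂ) r, (p.1, u) ∈ ball (0 : ℂ × ℂ) r := by
    intro u hu
    rw [← Prod.mk_zero_zero, ← ball_prod_same]
    exact ⟨hp'.1, hu⟩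
  have := mul_integral_segment (c := 0) (R := r) (a := 0) (w := p.2) (N := fun u => V (p.1, u))
    (f := fun u => fderiv ℂ V (p.1, u) (0, 1)) ?_ ?_ (by simpa using hr) (by simpa using hp'.2)
  · simp only [zero_add, hp0, sub_zero] at this
    exact this.symm
  · intro u hu
    have h1 := (hball _ (hmem u hu)).differentiableAt.hasFDerivAt
    have h2 : HasDerivAt (fun u : ℂ => (p.1, u)) (0, 1) u :=
      (hasDerivAt_const u p.1).prodMk (hasDerivAt_id u)
    exact h1.comp_hasDerivAt u h2
  · intro u hu
    have h1 : ContinuousAt (fun p => fderiv ℂ V p (0, 1)) (p.1, u) :=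
      
      (((ContinuousLinearMap.apply ℂ ℂ ((0 : ℂ), (1 : ℂ))).analyticAt _).comp
        (hball _ (hmem u hu)).fderiv).continuousAt
    exact (h1.comp (f := fun u : ℂ => (p.1, u)) (by fun_prop)).continuousWithinAt

/-- Analytic primitives with respect to the first variable. -/
theorem AnalyticAt.exists_hasDerivAt_fst {Q : ℂ × ℂ → ℂ} (hQ : AnalyticAt ℂ Q 0) :
    ∃ T : ℂ × ℂ → ℂ, AnalyticAt ℂ T 0 ∧ T 0 = 0 ∧
      ∀ᶠ p in nhds (0 : ℂ × ℂ), HasDerivAt (fun z => T (z, p.2)) (Q p) p.1 := by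
  have hQs : AnalyticAt ℂ (fun p : ℂ × ℂ => Q p.swap) 0 :=
    hQ.fun_comp_of_eq (analyticAt_snd.prod analyticAt_fst) rfl
  have hA := hQs.integral_comp_mul_snd.fun_comp_of_eq (f := fun p : ℂ × ℂ => p.swap) (x := 0)
    (analyticAt_snd.prod analyticAt_fst) rfl
  refine ⟨_, analyticAt_fst.mul hA, by simp, ?_⟩
  obtain ⟨r, hr, hball⟩ := Metric.eventually_nhds_iff_ball.1 hQ.eventually_analyticAt
  filter_upwards [ball_mem_nhds (0 : ℂ × ℂ) hr] with p hp
  have hp' : p.1 ∈ ball (0 : ℂ) r ∧ p.2 ∈ ball (0 : ℂ) r := by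
    rwa [← Prod.mk_zero_zero, ← ball_prod_same, mem_prod] at hp
  have hdiff : DifferentiableOn ℂ (fun z => Q (z, p.2)) (ball 0 r) := by
    intro z hz
    have hm : (z, p.2) ∈ ball (0 : ℂ × ℂ) r := by
      rw [← Prod.mk_zero_zero, ← ball_prod_same]
      exact ⟨hz, hp'.2⟩
    have := (hball _ hm).differentiableAt
    exact (this.comp (f := fun z : ℂ => (z, p.2)) z (by fun_prop)).differentiableWithinAt
  obtain ⟨N, hN⟩ := hdiff.isExactOn_ball
  refine ((hN p.1 hp'.1).sub_const (N 0)).congr_of_eventuallyEq ?_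
  filter_upwards [isOpen_ball.mem_nhds hp'.1] with z hz
  have := mul_integral_segment hN hdiff.continuousOn (a := 0) (w := z) (by simpa using hr)
    (by simpa using hz)
  simpa using this

/-- An analytic function vanishing on `{z ^ n = ε}` is divisible by `z ^ n - ε`. -/
theorem AnalyticAt.exists_eq_pow_sub_mul {f : ℂ × ℂ → ℂ} (hf : AnalyticAt ℂ f 0) {n : ℕ}
    (hn : n ≠ 0) (h0 : ∀ᶠ δ in nhds (0 : ℂ), f (δ, δ ^ n) = 0) :
    ∃ Q : ℂ × ℂ → ℂ, AnalyticAt ℂ Q 0 ∧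
      ∀ᶠ p in nhds (0 : ℂ × ℂ), f p = (p.1 ^ n - p.2) * Q p := by
  have hs : AnalyticAt ℂ (fun p : ℂ × ℂ => (p.1, p.1 ^ n - p.2)) 0 :=
    analyticAt_fst.prod ((analyticAt_fst.pow n).sub analyticAt_snd)
  have hs0 : (fun p : ℂ × ℂ => (p.1, p.1 ^ n - p.2)) 0 = 0 := by simp [hn]
  obtain ⟨W, hW, hWe⟩ := AnalyticAt.exists_eq_snd_mul (V := fun p => f (p.1, p.1 ^ n - p.2))
    (hf.comp_of_eq hs hs0) (by simpa using h0)
  refine ⟨_, hW.comp_of_eq hs hs0, ?_⟩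
  have hc : Tendsto (fun p : ℂ × ℂ => (p.1, p.1 ^ n - p.2)) (nhds 0) (nhds 0) := by
    simpa only [hs0] using hs.continuousAt.tendsto
  filter_upwards [hc.eventually hWe] with p hp
  simpa using hp

/-- Local analytic roots of a nonvanishing analytic function. -/
theorem AnalyticAt.exists_pow_eq {f : ℂ → ℂ} {x : ℂ} (hf : AnalyticAt ℂ f x) (h0 : f x ≠ 0)
    {n : ℕ} (hn : n ≠ 0) :
    ∃ c : ℂ → ℂ, AnalyticAt ℂ c x ∧ c x ≠ 0 ∧ ∀ z, c z ^ n = f z := by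
  obtain ⟨a, ha⟩ := IsAlgClosed.exists_pow_nat_eq (f x) (Nat.pos_of_ne_zero hn)
  have hc : ∀ z, (a * (f z / f x) ^ ((n : ℂ)⁻¹)) ^ n = f z := by
    intro z
    rw [mul_pow, ha, Complex.cpow_nat_inv_pow _ hn, mul_div_cancel₀ _ h0]
  refine ⟨_, analyticAt_const.mul ((hf.div analyticAt_const h0).cpow analyticAt_const ?_), ?_, hc⟩
  · simp [div_self h0]
  · intro h
    have := hc x
    rw [show a * (f x / f x) ^ ((n : ℂ)⁻¹) = 0 from h, zero_pow hn] at this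
    exact h0 this.symm

/-- The quotient `((z + s u) ^ n - ε) / u` with `u = z ^ n - ε`, as a polynomial in
`q = ((z, ε), s)`. -/
def powSubQuot (n : ℕ) (q : (ℂ × ℂ) × ℂ) : ℂ :=
  1 + q.2 * ∑ i ∈ Finset.range n,
    (q.1.1 + q.2 * (q.1.1 ^ n - q.1.2)) ^ i * q.1.1 ^ (n - 1 - i)

theorem mul_powSubQuot (n : ℕ) (z ε s : ℂ) :
    (z ^ n - ε) * powSubQuot n ((z, ε), s) = (z + s * (z ^ n - ε)) ^ n - ε := by
  have := (Commute.all (z + s * (z ^ n - ε)) z).geom_sum₂_mul n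
  simp only [powSubQuot]
  linear_combination this

theorem analyticAt_powSubQuot (n : ℕ) (q : (ℂ × ℂ) × ℂ) : AnalyticAt ℂ (powSubQuot n) q := by
  have h1 : AnalyticAt ℂ (fun q : (ℂ × ℂ) × ℂ => q.1.1) q :=
    analyticAt_fst.fun_comp_of_eq analyticAt_fst rfl
  have h2 : AnalyticAt ℂ (fun q : (ℂ × ℂ) × ℂ => q.1.2) q :=
    analyticAt_snd.fun_comp_of_eq analyticAt_fst rfl
  exact analyticAt_const.add (analyticAt_snd.mul (Finset.analyticAt_fun_sum _ fun i _ =>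
    ((h1.add (analyticAt_snd.mul ((h1.pow n).sub h2))).pow i).mul (h1.pow _)))

/-- Solution `χ` of `∂χ/∂z / (χ ^ n - ε) = 1 / (z ^ n - ε) + Q`, near the identity. -/
theorem exists_rectification {Q : ℂ × ℂ → ℂ} (hQ : AnalyticAt ℂ Q 0) (n : ℕ) :
    ∃ g : ℂ × ℂ → ℂ, AnalyticAt ℂ g 0 ∧ g 0 = 0 ∧
      ∀ᶠ p in nhds (0 : ℂ × ℂ),
        deriv (fun z => z + g (z, p.2) * (z ^ n - p.2)) p.1 * (p.1 ^ n - p.2) =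
          ((p.1 + g p * (p.1 ^ n - p.2)) ^ n - p.2) * (1 + (p.1 ^ n - p.2) * Q p) := by
  obtain ⟨T, hT, hT0, hTd⟩ := hQ.exists_hasDerivAt_fst
  have hD0 : powSubQuot n 0 = 1 := by simp [powSubQuot]
  have hDa := analyticAt_powSubQuot n
  have hDinv : AnalyticAt ℂ (fun q => (powSubQuot n q)⁻¹) 0 := (hDa 0).fun_inv (by simp [hD0])
  have hI := hDinv.integral_comp_mul_snd
  set I : (ℂ × ℂ) × ℂ → ℂ :=
    fun q => ∫ τ in (0 : ℝ)..1, (powSubQuot n (q.1, (τ : ℂ) * q.2))⁻¹ with hIdef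
  have hI0 : I 0 = 1 := by
    have : powSubQuot n ((0 : ℂ × ℂ), (0 : ℂ)) = 1 := hD0
    simp [hIdef, this]
  set G : (ℂ × ℂ) × ℂ → ℂ := fun q => q.2 * I q - T q.1 with hG
  have hGa : AnalyticAt ℂ G 0 :=
    (analyticAt_snd.mul hI).sub (hT.fun_comp_of_eq analyticAt_fst rfl)
  have hGc : ContDiffAt ℂ ⊤ G 0 := hGa.contDiffAt
  have hG0 : G 0 = 0 := by simp [hG, hT0]
  have hinv : fderiv ℂ G 0 ∘L .inr ℂ (ℂ × ℂ) ℂ = .id ℂ ℂ := by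
    have h1 : HasDerivAt (fun s : ℂ => ((0 : ℂ × ℂ), s)) (0, 1) 0 :=
      (hasDerivAt_const _ _).prodMk (hasDerivAt_id _)
    have h2 : HasDerivAt (fun s : ℂ => G (0, s)) (fderiv ℂ G 0 (0, 1)) 0 :=
      HasFDerivAt.comp_hasDerivAt (0 : ℂ) (f := fun s : ℂ => ((0 : ℂ × ℂ), s))
        hGa.differentiableAt.hasFDerivAt h1
    have h3 : DifferentiableAt ℂ (fun s : ℂ => I (0, s)) 0 :=
      DifferentiableAt.comp (0 : ℂ) (f := fun s : ℂ => ((0 : ℂ × ℂ), s)) (g := I)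
        hI.differentiableAt h1.differentiableAt
    have h4 : HasDerivAt (fun s : ℂ => G (0, s)) 1 0 := by
      have h := ((hasDerivAt_id (0 : ℂ)).mul h3.hasDerivAt).sub_const (T 0)
      have hI0' : I (0, 0) = 1 := hI0
      simpa [hI0', hG, hT0] using h
    ext
    simpa using h2.unique h4
  have hif : (fderiv ℂ G 0 ∘L .inr ℂ (ℂ × ℂ) ℂ).IsInvertible := by
    rw [hinv]; exact ⟨.refl ℂ ℂ, rfl⟩
  set g := hGc.implicitFunction (by simp) hif with hg
  have hga : AnalyticAt ℂ g 0 := (hGc.contDiffAt_implicitFunction (by simp) hif).analyticAt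
  have hg0 : g 0 = 0 := hGc.implicitFunction_apply_self (by simp) hif
  have hge : ∀ᶠ p in nhds (0 : ℂ × ℂ), G (p, g p) = 0 := by
    have := hGc.eventually_apply_implicitFunction (by simp) hif
    rw [hG0] at this
    exact this
  refine ⟨g, hga, hg0, ?_⟩
  obtain ⟨r, hr, hDr⟩ := Metric.eventually_nhds_iff_ball.1
    ((hDa 0).continuousAt.eventually_ne (y := 0) (by simp [hD0]))
  have hgr : ∀ᶠ p in nhds (0 : ℂ × ℂ), ‖g p‖ < r := by
    have := hga.continuousAt.norm
    refine this.eventually_lt continuousAt_const ?_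
    simpa [hg0] using hr
  filter_upwards [hge.eventually_nhds, hga.eventually_analyticAt, hTd, hgr,
    ball_mem_nhds (0 : ℂ × ℂ) hr] with p hGp hgp hTp hgrp hpr
  obtain ⟨z₀, ε⟩ := p
  simp only at hTp ⊢
  by_cases hu : z₀ ^ n - ε = 0
  · simp [hu]
  set χ : ℂ → ℂ := fun z => z + g (z, ε) * (z ^ n - ε) with hχ
  have hemb : ContinuousAt (fun z : ℂ => (z, ε)) z₀ := by fun_prop
  have hχd : DifferentiableAt ℂ χ z₀ := by
    have : DifferentiableAt ℂ (fun z => g (z, ε)) z₀ :=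
      DifferentiableAt.comp z₀ (f := fun z : ℂ => (z, ε)) (g := g)
        hgp.differentiableAt (by fun_prop)
    simp only [hχ]
    fun_prop
  set R := r * ‖z₀ ^ n - ε‖ with hR
  have hup : 0 < ‖z₀ ^ n - ε‖ := norm_pos_iff.2 hu
  have hRp : 0 < R := mul_pos hr hup
  have hne : ∀ y ∈ ball z₀ R, y ^ n - ε ≠ 0 := by
    intro y hy
    have hs : y = z₀ + (y - z₀) / (z₀ ^ n - ε) * (z₀ ^ n - ε) := by
      rw [div_mul_cancel₀ _ hu]; ring
    have hm := mul_powSubQuot n z₀ ε ((y - z₀) / (z₀ ^ n - ε))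
    rw [← hs] at hm
    rw [← hm]
    refine mul_ne_zero hu (hDr _ ?_)
    rw [← Prod.mk_zero_zero, ← ball_prod_same]
    refine ⟨hpr, ?_⟩
    rw [mem_ball_zero_iff, norm_div, div_lt_iff₀ hup]
    rwa [mem_ball_iff_norm] at hy
  have hFd : DifferentiableOn ℂ (fun y : ℂ => (y ^ n - ε)⁻¹) (ball z₀ R) :=
    DifferentiableOn.fun_inv (by fun_prop) hne
  obtain ⟨N, hN⟩ := hFd.isExactOn_ball
  have hχ0 : χ z₀ ∈ ball z₀ R := by
    rw [mem_ball_iff_norm]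
    simp only [hχ, add_sub_cancel_left, norm_mul, hR]
    gcongr
  have hev : ∀ᶠ z in nhds z₀, N (χ z) - N z = T (z, ε) := by
    filter_upwards [isOpen_ball.mem_nhds (mem_ball_self hRp),
      hχd.continuousAt.eventually (isOpen_ball.mem_nhds hχ0), hemb.eventually hGp]
      with z hz hχz hGz
    have hseg := mul_integral_segment hN hFd.continuousOn hz hχz
    have hT' : T (z, ε) = g (z, ε) * I ((z, ε), g (z, ε)) := by
      simp only [hG] at hGz
      exact (sub_eq_zero.1 hGz).symm
    rw [hT', ← hseg, mul_assoc, ← intervalIntegral.integral_const_mul]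
    congr 1
    refine intervalIntegral.integral_congr fun τ _ => ?_
    have hm := mul_powSubQuot n z ε (τ * g (z, ε))
    simp only
    rw [← mul_assoc, ← hm, mul_inv, ← mul_assoc, mul_inv_cancel₀ (hne z hz), one_mul]
  have hd1 : HasDerivAt (fun z => N (χ z) - N z)
      ((χ z₀ ^ n - ε)⁻¹ * deriv χ z₀ - (z₀ ^ n - ε)⁻¹) z₀ :=
    ((hN _ hχ0).comp z₀ hχd.hasDerivAt).sub (hN _ (mem_ball_self hRp))
  have heq := hd1.unique (hTp.congr_of_eventuallyEq hev)
  have hχne := hne _ hχ0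
  have hχval : χ z₀ = z₀ + g (z₀, ε) * (z₀ ^ n - ε) := rfl
  rw [← hχval]
  field_simp at heq
  linear_combination heq

/-- A perturbation of the identity by a product of two functions vanishing at the origin is
injective in `z`, uniformly in the parameter. -/
theorem exists_injOn_add_mul {g u : ℂ × ℂ → ℂ} (hg : AnalyticAt ℂ g 0) (hg0 : g 0 = 0)
    (hu : AnalyticAt ℂ u 0) (hu0 : u 0 = 0) :
    ∃ r > 0, ∀ ε ∈ ball (0 : ℂ) r, InjOn (fun z => z + g (z, ε) * u (z, ε)) (ball 0 r) := by
  have hd : HasStrictFDerivAt (fun p : ℂ × ℂ => p.1 + g p * u p)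
      (ContinuousLinearMap.fst ℂ ℂ ℂ) 0 := by
    have := (hasStrictFDerivAt_fst (𝕜 := ℂ) (p := (0 : ℂ × ℂ))).add
      (hg.hasStrictFDerivAt.mul hu.hasStrictFDerivAt)
    refine this.congr_fderiv ?_
    ext <;> simp [hg0, hu0]
  obtain ⟨s, hs, happ⟩ := hd.approximates_deriv_on_nhds (c := 1 / 2) (Or.inr (by norm_num))
  obtain ⟨r, hr, hrs⟩ := Metric.mem_nhds_iff.1 hs
  refine ⟨r, hr, fun ε hε z hz w hw h => ?_⟩
  have hmem : ∀ z ∈ ball (0 : ℂ) r, (z, ε) ∈ s := fun z hz => hrs (by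
    rw [← Prod.mk_zero_zero, ← ball_prod_same]
    exact ⟨hz, hε⟩)
  have hb := happ (z, ε) (hmem z hz) (w, ε) (hmem w hw)
  simp only at h
  simp only [h, sub_self, zero_sub, norm_neg, Prod.mk_sub_mk, ContinuousLinearMap.coe_fst',
    Prod.norm_mk, norm_zero, norm_nonneg, sup_of_le_left] at hb
  norm_num at hb
  have h0 : ‖z - w‖ = 0 := by linarith [norm_nonneg (z - w)]
  exact sub_eq_zero.1 (norm_eq_zero.1 h0)

/-- Cancelling `δ ^ k` in the equation for the natural eigenvalue function. -/
theorem eventually_eq_of_eigenvalue_eq {k : ℕ} {v : ℂ → ℂ → ℂ}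
    (hv : AnalyticAt ℂ (fun p : ℂ × ℂ => v p.1 p.2) (0, 0)) {σ : ℂ → ℂ} (hσ : AnalyticAt ℂ σ 0)
    (h : ∀ᶠ δ in nhds (0 : ℂ),
      ((k : ℂ) + 1) * δ ^ k * v δ (δ ^ (k + 1)) = δ ^ k * σ (δ ^ (k + 1))) :
    ∀ᶠ δ in nhds (0 : ℂ), ((k : ℂ) + 1) * v δ (δ ^ (k + 1)) = σ (δ ^ (k + 1)) := by
  have h1 : ContinuousAt (fun δ : ℂ => ((k : ℂ) + 1) * v δ (δ ^ (k + 1))) 0 :=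
    continuousAt_const.mul (ContinuousAt.comp_of_eq (f := fun δ : ℂ => (δ, δ ^ (k + 1)))
      hv.continuousAt (by fun_prop) (by simp))
  have h2 : ContinuousAt (fun δ : ℂ => σ (δ ^ (k + 1))) 0 :=
    ContinuousAt.comp_of_eq (f := fun δ : ℂ => δ ^ (k + 1)) hσ.continuousAt (by fun_prop) (by simp)
  refine (h1.eventuallyEq_nhds_iff_eventuallyEq_nhdsNE h2).1 ?_
  filter_upwards [h.filter_mono nhdsWithin_le_nhds, self_mem_nhdsWithin] with δ hδ hδ0
  have : δ ^ k ≠ 0 := pow_ne_zero _ hδ0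
  apply mul_left_cancel₀ this
  linear_combination hδ

/-- A natural eigenvalue function of the form `δ ^ k * σ (δ ^ (k + 1))` yields a conjugacy with
the model family. -/
theorem exists_conjugacy_of_eigenvalue_eq {k : ℕ} (hk : 1 ≤ k) {v : ℂ → ℂ → ℂ}
    (hv : AnalyticAt ℂ (fun p : ℂ × ℂ => v p.1 p.2) (0, 0)) (hv0 : v 0 0 ≠ 0)
    {σ : ℂ → ℂ} (hσ : AnalyticAt ℂ σ 0) (hσ0 : σ 0 ≠ 0)
    (h : ∀ᶠ δ in nhds (0 : ℂ),
      ((k : ℂ) + 1) * δ ^ k * v δ (δ ^ (k + 1)) = δ ^ k * σ (δ ^ (k + 1))) :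
    ∃ (r ρ : ℝ) (ψ : ℂ → ℂ → ℂ) (h : ℂ → ℂ), 0 < r ∧ 0 < ρ ∧
      AnalyticOnNhd ℂ (fun p : ℂ × ℂ => ψ p.1 p.2) (ball 0 r ×ˢ ball 0 ρ) ∧
      ψ 0 0 = 0 ∧
      (∀ ε ∈ ball (0 : ℂ) ρ, Set.InjOn (fun z => ψ z ε) (ball 0 r)) ∧
      AnalyticOnNhd ℂ h (ball 0 ρ) ∧ h 0 = 0 ∧ deriv h 0 ≠ 0 ∧
      ∀ z ∈ ball (0 : ℂ) r, ∀ ε ∈ ball (0 : ℂ) ρ,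
        deriv (fun z => ψ z ε) z * ((z ^ (k + 1) - ε) * v z ε)
          = ψ z ε ^ (k + 1) - h ε := by
  have hk1 : (k : ℂ) + 1 ≠ 0 := by exact_mod_cast Nat.succ_ne_zero k
  obtain ⟨c, hc, hc0, hck⟩ := AnalyticAt.exists_pow_eq (f := fun ε => σ ε / ((k : ℂ) + 1))
    (hσ.div analyticAt_const hk1) (div_ne_zero hσ0 hk1) (n := k) (by omega)
  have hc2 : AnalyticAt ℂ (fun p : ℂ × ℂ => c p.2) 0 := hc.fun_comp_of_eq analyticAt_snd rfl
  have hv' : AnalyticAt ℂ (fun p : ℂ × ℂ => v p.1 p.2) 0 := hv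
  have hvne : ∀ᶠ p in nhds (0 : ℂ × ℂ), v p.1 p.2 ≠ 0 := hv'.continuousAt.eventually_ne hv0
  have hdiag : ∀ᶠ δ in nhds (0 : ℂ), v δ (δ ^ (k + 1)) ≠ 0 := by
    have ht : Tendsto (fun δ : ℂ => (δ, δ ^ (k + 1))) (nhds 0) (nhds 0) := by
      have : ContinuousAt (fun δ : ℂ => (δ, δ ^ (k + 1))) 0 := by fun_prop
      simpa [ContinuousAt, ← Prod.mk_zero_zero] using this
    exact ht.eventually hvne
  obtain ⟨Q, hQ, hQe⟩ := AnalyticAt.exists_eq_pow_sub_mul (n := k + 1)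
    (f := fun p : ℂ × ℂ => c p.2 ^ k / v p.1 p.2 - 1)
    (((hc2.pow k).div hv' hv0).sub analyticAt_const) (by omega) (by
      filter_upwards [hdiag, eventually_eq_of_eigenvalue_eq hv hσ h] with δ h1 h2
      simp only [hck, ← h2]
      field_simp
      simp)
  obtain ⟨g, hg, hg0, hge⟩ := exists_rectification hQ (k + 1)
  obtain ⟨r₁, hr₁, hinj⟩ := exists_injOn_add_mul (u := fun p => p.1 ^ (k + 1) - p.2) hg hg0
    ((analyticAt_fst.pow _).sub analyticAt_snd) (by simp)
  have hcne : ∀ᶠ p in nhds (0 : ℂ × ℂ), c p.2 ≠ 0 := hc2.continuousAt.eventually_ne hc0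
  have hca : ∀ᶠ p in nhds (0 : ℂ × ℂ), AnalyticAt ℂ c p.2 :=
    ((continuous_snd (X := ℂ) (Y := ℂ)).tendsto (0 : ℂ × ℂ)).eventually hc.eventually_analyticAt
  obtain ⟨r₂, hr₂, hball⟩ := Metric.eventually_nhds_iff_ball.1
    (hvne.and (hQe.and (hge.and (hcne.and (hca.and hg.eventually_analyticAt)))))
  set r := min r₁ r₂ with hr
  have hr0 : 0 < r := lt_min hr₁ hr₂
  have hb1 : ball (0 : ℂ) r ⊆ ball 0 r₁ := ball_subset_ball (min_le_left _ _)
  have hb2 : ∀ z ∈ ball (0 : ℂ) r, ∀ ε ∈ ball (0 : ℂ) r, (z, ε) ∈ ball (0 : ℂ × ℂ) r₂ := by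
    intro z hz ε hε
    rw [← Prod.mk_zero_zero, ← ball_prod_same]
    exact ⟨ball_subset_ball (min_le_right _ _) hz, ball_subset_ball (min_le_right _ _) hε⟩
  have h0r : (0 : ℂ) ∈ ball (0 : ℂ) r := mem_ball_self hr0
  refine ⟨r, r, fun z ε => c ε * (z + g (z, ε) * (z ^ (k + 1) - ε)),
    fun ε => c ε ^ (k + 1) * ε, hr0, hr0, ?_, ?_, ?_, ?_, ?_, ?_, ?_⟩
  · rintro ⟨z, ε⟩ ⟨hz, hε⟩
    obtain ⟨-, -, -, -, ha, hga⟩ := hball _ (hb2 z hz ε hε)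
    exact (ha.fun_comp_of_eq analyticAt_snd rfl).mul (analyticAt_fst.add
      (hga.mul ((analyticAt_fst.pow _).sub analyticAt_snd)))
  · simp
  · intro ε hε z hz w hw hzw
    obtain ⟨-, -, -, hcε, -, -⟩ := hball _ (hb2 z hz ε hε)
    exact hinj ε (hb1 hε) (hb1 hz) (hb1 hw) (mul_left_cancel₀ hcε hzw)
  · intro ε hε
    obtain ⟨-, -, -, -, ha, -⟩ := hball _ (hb2 0 h0r ε hε)
    exact (ha.pow _).mul analyticAt_id
  · simp
  · have hd := ((hc.pow (k + 1)).differentiableAt.hasDerivAt).mul (hasDerivAt_id (0 : ℂ))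
    rw [show deriv (fun ε => c ε ^ (k + 1) * ε) 0 = _ from hd.deriv]
    simpa using hc0
  · intro z hz ε hε
    obtain ⟨hvz, hQz, hgz, -, -, -⟩ := hball _ (hb2 z hz ε hε)
    rw [deriv_const_mul_field]
    simp only at hvz hQz hgz ⊢
    have hQ' : (1 + (z ^ (k + 1) - ε) * Q (z, ε)) * v z ε = c ε ^ k := by
      rw [← hQz]
      field_simp
      ring
    calc _ = c ε * (deriv (fun z => z + g (z, ε) * (z ^ (k + 1) - ε)) z * (z ^ (k + 1) - ε))
          * v z ε := by ring
      _ = c ε * ((z + g (z, ε) * (z ^ (k + 1) - ε)) ^ (k + 1) - ε)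
          * ((1 + (z ^ (k + 1) - ε) * Q (z, ε)) * v z ε) := by rw [hgz]; ring
      _ = _ := by rw [hQ', mul_pow]; ring

/-- An injective analytic solution of `f' z ^ (k + 1) w = f ^ (k + 1)` has nonzero derivative
at the origin. -/
theorem deriv_ne_zero_of_pow_eq {k : ℕ} (hk : 1 ≤ k) {f w : ℂ → ℂ} (hf : AnalyticAt ℂ f 0)
    (hf0 : f 0 = 0) (hfc : ¬ ∀ᶠ z in nhds (0 : ℂ), f z = 0) (hw : AnalyticAt ℂ w 0) (hw0 : w 0 ≠ 0)
    (h : ∀ᶠ z in nhds (0 : ℂ), deriv f z * (z ^ (k + 1) * w z) = f z ^ (k + 1)) :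
    deriv f 0 ≠ 0 := by
  have h1 := hf.analyticOrderAt_deriv_add_one
  simp only [hf0, sub_zero] at h1
  have h2 : analyticOrderAt f 0 ≠ ⊤ := fun h => hfc (analyticOrderAt_eq_top.1 h)
  have hid : AnalyticAt ℂ (id : ℂ → ℂ) 0 := analyticAt_id
  have hid1 : analyticOrderAt (id : ℂ → ℂ) 0 = 1 := by
    exact hid.analyticOrderAt_eq_natCast (n := 1) |>.2
      ⟨fun _ => 1, analyticAt_const, one_ne_zero, by simp⟩
  have h3 := analyticOrderAt_congr (f := deriv f * (id ^ (k + 1) * w)) (g := f ^ (k + 1)) (z₀ := 0)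
    (by filter_upwards [h] with z hz; simpa using hz)
  rw [analyticOrderAt_mul hf.deriv ((hid.pow _).mul hw), analyticOrderAt_mul (hid.pow _) hw,
    analyticOrderAt_pow hid, analyticOrderAt_pow hf, hid1, hw.analyticOrderAt_eq_zero.2 hw0] at h3
  rw [← hf.deriv.analyticOrderAt_eq_zero]
  obtain ⟨a, ha⟩ := ENat.ne_top_iff_exists.1 h2
  have h4 : analyticOrderAt (deriv f) 0 ≠ ⊤ := by
    intro h; rw [h] at h1; exact h2 (by rw [← h1]; rfl)
  obtain ⟨b, hb⟩ := ENat.ne_top_iff_exists.1 h4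
  rw [← ha, ← hb] at h1 h3
  rw [← hb]
  have h1' : b + 1 = a := by exact_mod_cast h1
  have h3' : b + (k + 1) = (k + 1) * a := by
    simp only [nsmul_eq_mul, mul_one, add_zero] at h3
    exact_mod_cast h3
  subst h1'
  have : k * b = 0 := by nlinarith
  have : b = 0 := by
    rcases Nat.mul_eq_zero.1 this with h | h
    · omega
    · exact h
  simp [this]

/-- If `φ ^ n` is a function of `δ ^ n` with a simple zero, then `φ / δ` is a function of
`δ ^ n`. -/
theorem exists_pow_eq_pow_mul {n : ℕ} (hn : n ≠ 0) {φ h : ℂ → ℂ} (hφ : AnalyticAt ℂ φ 0)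
    (hφ0 : φ 0 = 0) (hh : AnalyticAt ℂ h 0) (hh0 : h 0 = 0) (hh' : deriv h 0 ≠ 0)
    (heq : ∀ᶠ δ in nhds (0 : ℂ), φ δ ^ n = h (δ ^ n)) :
    ∃ R : ℂ → ℂ, AnalyticAt ℂ R 0 ∧ R 0 ≠ 0 ∧ ∀ᶠ δ in nhds (0 : ℂ), φ δ = δ * R (δ ^ n) := by
  have hdsl : ∀ {f : ℂ → ℂ}, AnalyticAt ℂ f 0 → AnalyticAt ℂ (dslope f 0) 0 := by
    intro f hf
    obtain ⟨p, hp⟩ := hf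
    exact hp.has_fpower_series_dslope_fslope.analyticAt
  have hmul : ∀ {f : ℂ → ℂ}, f 0 = 0 → ∀ z, f z = z * dslope f 0 z := by
    intro f hf z
    have := sub_smul_dslope f 0 z
    simpa [hf] using this.symm
  obtain ⟨S, hS, hS0, hSn⟩ := (hdsl hh).exists_pow_eq (by rwa [dslope_same]) hn
  have hφc := (hdsl hφ).continuousAt
  have ht : ContinuousAt (fun δ : ℂ => δ ^ n) 0 := by fun_prop
  have hSc : ContinuousAt (fun δ : ℂ => S (δ ^ n)) 0 :=
    ContinuousAt.comp_of_eq (f := fun δ : ℂ => δ ^ n) hS.continuousAt ht (by simp [hn])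
  have hSne : ∀ᶠ δ in nhds (0 : ℂ), S (δ ^ n) ≠ 0 := hSc.eventually_ne (by simpa [hn] using hS0)
  have hpow : ∀ᶠ δ in nhds (0 : ℂ), dslope φ 0 δ ^ n = S (δ ^ n) ^ n := by
    refine ((hφc.pow n).eventuallyEq_nhds_iff_eventuallyEq_nhdsNE (hSc.pow n)).1 ?_
    filter_upwards [heq.filter_mono nhdsWithin_le_nhds, self_mem_nhdsWithin] with δ hδ hδ0
    have : δ ^ n ≠ 0 := pow_ne_zero _ hδ0
    apply mul_left_cancel₀ this
    simp only [Pi.pow_apply]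
    rw [hSn, ← mul_pow, ← hmul hφ0, ← hmul hh0, hδ]
  set q : ℂ → ℂ := fun δ => dslope φ 0 δ / S (δ ^ n) with hq
  have hqc : ContinuousAt q 0 := hφc.div hSc (by simpa [hn] using hS0)
  have hq1 : ∀ᶠ δ in nhds (0 : ℂ), q δ ^ n = 1 := by
    filter_upwards [hpow, hSne] with δ h1 h2
    rw [hq, div_pow, h1, div_self (pow_ne_zero _ h2)]
  have hfin : {x : ℂ | x ^ n = 1}.Finite := by
    refine (Polynomial.nthRootsFinset n (1 : ℂ)).finite_toSet.subset fun x hx => ?_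
    simpa [Polynomial.mem_nthRootsFinset (Nat.pos_of_ne_zero hn)] using hx
  have hqe : ∀ᶠ δ in nhds (0 : ℂ), q δ = q 0 := by
    have hcl : IsClosed ({x : ℂ | x ^ n = 1} \ {q 0}) := (hfin.subset sdiff_subset).isClosed
    filter_upwards [hq1, hqc.eventually (hcl.isOpen_compl.mem_nhds (by simp))] with δ h1 h2
    by_contra hne
    exact h2 ⟨h1, hne⟩
  have hq0 : q 0 ≠ 0 := by
    intro h0
    have := hq1.self_of_nhds
    rw [h0, zero_pow hn] at this
    exact zero_ne_one this
  refine ⟨fun ε => q 0 * S ε, analyticAt_const.mul hS, mul_ne_zero hq0 hS0, ?_⟩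
  filter_upwards [hqe, hSne] with δ h1 h2
  rw [hmul hφ0 δ, ← h1, hq, div_mul_cancel₀ _ h2]

/-- A factored family `ω(z,ε) = (z^{k+1}−ε)·v(z,ε)` of codimension `k`
is conjugate, by an analytic change of coordinate and parameter `(ψ, h)`, to the model
family `z^{k+1} − ε` if and only if its natural eigenvalue function
`λ(δ) = (k+1)δ^k v(δ,δ^{k+1})` has the form `λ(δ) = δ^k·σ(δ^{k+1})` with `σ` analytic,
`σ(0) ≠ 0`. -/
theorem statement17 (k : ℕ) (hk : 1 ≤ k) (v : ℂ → ℂ → ℂ)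
    (hv : AnalyticAt ℂ (fun p : ℂ × ℂ => v p.1 p.2) (0, 0)) (hv0 : v 0 0 ≠ 0) :
    (∃ (r ρ : ℝ) (ψ : ℂ → ℂ → ℂ) (h : ℂ → ℂ), 0 < r ∧ 0 < ρ ∧
      AnalyticOnNhd ℂ (fun p : ℂ × ℂ => ψ p.1 p.2) (ball 0 r ×ˢ ball 0 ρ) ∧
      ψ 0 0 = 0 ∧
      (∀ ε ∈ ball (0 : ℂ) ρ, Set.InjOn (fun z => ψ z ε) (ball 0 r)) ∧
      AnalyticOnNhd ℂ h (ball 0 ρ) ∧ h 0 = 0 ∧ deriv h 0 ≠ 0 ∧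
      ∀ z ∈ ball (0 : ℂ) r, ∀ ε ∈ ball (0 : ℂ) ρ,
        deriv (fun z => ψ z ε) z * ((z ^ (k + 1) - ε) * v z ε)
          = ψ z ε ^ (k + 1) - h ε) ↔
    (∃ σ : ℂ → ℂ, AnalyticAt ℂ σ 0 ∧ σ 0 ≠ 0 ∧
      ∀ᶠ δ in nhds (0 : ℂ),
        ((k : ℂ) + 1) * δ ^ k * v δ (δ ^ (k + 1)) = δ ^ k * σ (δ ^ (k + 1))) := by
  refine ⟨?_, fun ⟨σ, hσ, hσ0, h⟩ => exists_conjugacy_of_eigenvalue_eq hk hv hv0 hσ hσ0 h⟩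
  rintro ⟨r, ρ, ψ, h, hr, hρ, hψ, hψ0, hinj, hh, hh0, hh', heq⟩
  have hk1 : (k : ℂ) + 1 ≠ 0 := by exact_mod_cast Nat.succ_ne_zero k
  have h0r : (0 : ℂ) ∈ ball (0 : ℂ) r := mem_ball_self hr
  have h0ρ : (0 : ℂ) ∈ ball (0 : ℂ) ρ := mem_ball_self hρ
  have hslice : ∀ z ∈ ball (0 : ℂ) r, ∀ ε ∈ ball (0 : ℂ) ρ,
      AnalyticAt ℂ (fun z => ψ z ε) z := fun z hz ε hε =>
    (hψ (z, ε) ⟨hz, hε⟩).fun_comp_of_eq (f := fun z : ℂ => (z, ε))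
      (analyticAt_id.prod analyticAt_const) rfl
  have hdiagA : AnalyticAt ℂ (fun δ : ℂ => (δ, δ ^ (k + 1))) 0 :=
    analyticAt_id.prod (analyticAt_id.pow _)
  have hdiagT : Tendsto (fun δ : ℂ => (δ, δ ^ (k + 1))) (nhds 0) (nhds (0, 0)) := by
    simpa [ContinuousAt] using hdiagA.continuousAt
  have hφ : AnalyticAt ℂ (fun δ => ψ δ (δ ^ (k + 1))) 0 :=
    (hψ (0, 0) ⟨h0r, h0ρ⟩).fun_comp_of_eq hdiagA (by simp)
  have hd0 : deriv (fun z => ψ z 0) 0 ≠ 0 := by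
    refine deriv_ne_zero_of_pow_eq hk (w := fun z => v z 0) (hslice 0 h0r 0 h0ρ) hψ0 ?_
      (hv.fun_comp_of_eq (f := fun z : ℂ => (z, (0 : ℂ)))
        (analyticAt_id.prod analyticAt_const) rfl) hv0 ?_
    · intro hz
      have h1 := (hz.and (isOpen_ball.mem_nhds h0r)).filter_mono
        (nhdsWithin_le_nhds (s := {(0 : ℂ)}ᶜ))
      obtain ⟨z, ⟨hz, hzr⟩, hz0⟩ := (h1.and self_mem_nhdsWithin).exists
      exact hz0 (hinj 0 h0ρ hzr h0r (hz.trans hψ0.symm))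
    · filter_upwards [isOpen_ball.mem_nhds h0r] with z hz
      simpa [hh0] using heq z hz 0 h0ρ
  have hprod : ∀ᶠ p in nhds ((0 : ℂ), (0 : ℂ)), p ∈ ball (0 : ℂ) r ×ˢ ball (0 : ℂ) ρ :=
    (isOpen_ball.prod isOpen_ball).mem_nhds ⟨h0r, h0ρ⟩
  have hφe : ∀ᶠ δ in nhds (0 : ℂ), ψ δ (δ ^ (k + 1)) ^ (k + 1) = h (δ ^ (k + 1)) := by
    filter_upwards [hdiagT.eventually hprod] with δ hδ
    have := heq δ hδ.1 _ hδ.2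
    rw [sub_self, zero_mul, mul_zero] at this
    exact (sub_eq_zero.1 this.symm)
  obtain ⟨R, hR, hR0, hRe⟩ := exists_pow_eq_pow_mul (n := k + 1) (by omega) hφ
    (by simpa using hψ0) (hh 0 h0ρ) hh0 hh' hφe
  refine ⟨fun ε => ((k : ℂ) + 1) * R ε ^ k, analyticAt_const.mul (hR.pow k),
    mul_ne_zero hk1 (pow_ne_zero _ hR0), ?_⟩
  have hdne : ∀ᶠ δ in nhds (0 : ℂ), deriv (fun z => ψ z (δ ^ (k + 1))) δ ≠ 0 := by
    have hpd : AnalyticAt ℂ (fun p => fderiv ℂ (fun p : ℂ × ℂ => ψ p.1 p.2) p (1, 0)) (0, 0) :=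
      ((ContinuousLinearMap.apply ℂ ℂ ((1 : ℂ), (0 : ℂ))).analyticAt _).comp
        (hψ (0, 0) ⟨h0r, h0ρ⟩).fderiv
    have hval : ∀ z ∈ ball (0 : ℂ) r, ∀ ε ∈ ball (0 : ℂ) ρ,
        deriv (fun z => ψ z ε) z = fderiv ℂ (fun p : ℂ × ℂ => ψ p.1 p.2) (z, ε) (1, 0) := by
      intro z hz ε hε
      have h1 : HasDerivAt (fun z : ℂ => (z, ε)) (1, 0) z :=
        (hasDerivAt_id z).prodMk (hasDerivAt_const z ε)
      exact ((hψ (z, ε) ⟨hz, hε⟩).differentiableAt.hasFDerivAt.comp_hasDerivAt z h1).deriv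
    have hne := hpd.continuousAt.eventually_ne (y := 0) (by rw [← hval 0 h0r 0 h0ρ]; exact hd0)
    filter_upwards [hdiagT.eventually hne, hdiagT.eventually hprod] with δ h1 h2
    rwa [hval _ h2.1 _ h2.2]
  filter_upwards [hdne, hRe, hdiagT.eventually hprod, hdiagT.eventually hv.eventually_analyticAt]
    with δ hδ hRδ hmem hvδ
  obtain ⟨hδr, hδρ⟩ := hmem
  simp only at hδr hδρ
  set ε := δ ^ (k + 1) with hε
  have hψd := hslice δ hδr ε hδρ
  have hvd : AnalyticAt ℂ (fun z => v z ε) δ := hvδ.fun_comp_of_eq (f := fun z : ℂ => (z, ε))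
    (analyticAt_id.prod analyticAt_const) rfl
  have hud : HasDerivAt (fun z : ℂ => z ^ (k + 1) - ε) (((k : ℂ) + 1) * δ ^ k) δ := by
    simpa using (hasDerivAt_pow (k + 1) δ).sub_const ε
  have hL := hψd.deriv.differentiableAt.hasDerivAt.mul
    (hud.mul hvd.differentiableAt.hasDerivAt)
  have hRt := (hψd.differentiableAt.hasDerivAt.pow (k + 1)).sub_const (h ε)
  have hLR := hL.unique (hRt.congr_of_eventuallyEq (by
    filter_upwards [isOpen_ball.mem_nhds hδr] with z hz
    simpa using heq z hz ε hδρ))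
  have hu0 : δ ^ (k + 1) - ε = 0 := by rw [hε, sub_self]
  simp only [Pi.mul_apply, hu0, zero_mul, mul_zero, add_zero, zero_add, Nat.add_sub_cancel,
    Nat.cast_add, Nat.cast_one] at hLR
  apply mul_left_cancel₀ hδ
  rw [hLR, hRδ, mul_pow]
  ring
end
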